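/- Taylor coefficients as surface integrals: let 0 < ρ < R and let f be monogenic (hence smooth) on the open ball {x ∈ ℝ³ : |x| < R}. Then for all integers 0 ≤ l ≤ n, (1/n!)·(∂̄_ℂ^l ∂₀^{n−l} f)(0) = ((n+1)/(4^{l+1}·π))·∫_{S²_ρ} conj(A_{−(n+2)}^l(ȳ))·(y/|y|)·f(y) dσ(y), where S²_ρ = {y ∈ ℝ³ : |y| = ρ} carries its surface measure σ, ȳ is the conjugate reduced quaternion of y, and the product inside the integral is the quaternion product in the indicated order. -/

import Mathlib

open MeasureTheory Metric Finset

noncomputable section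

/-- `ℝ³` with the Euclidean norm and Lebesgue measure. -/
abbrev R3 := EuclideanSpace ℝ (Fin 3)
/-- the real quaternions ℍ -/
abbrev QH := Quaternion ℝ

/-- the basis quaternion e₁ -/
def e1 : QH := ⟨0,1,0,0⟩
/-- the basis quaternion e₂ -/
def e2 : QH := ⟨0,0,1,0⟩
/-- the basis quaternion e₃ -/
def e3 : QH := ⟨0,0,0,1⟩

/-- embed a point of ℝ³ as the reduced quaternion x₀ + x₁e₁ + x₂e₂ -/
def toQ (x : R3) : QH := ⟨x 0, x 1, x 2, 0⟩
/-- the conjugate reduced quaternion x₀ - x₁e₁ - x₂e₂ -/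
def toQbar (x : R3) : QH := ⟨x 0, -(x 1), -(x 2), 0⟩
/-- ζ = x₁ - x₂e₃ -/
def zeta (x : R3) : QH := ⟨x 1, 0, 0, -(x 2)⟩

/-- build a point of ℝ³ from coordinates -/
def mk3 (a b c : ℝ) : R3 := (WithLp.equiv 2 (Fin 3 → ℝ)).symm ![a, b, c]

/-- the conjugated point (x₀, -x₁, -x₂) -/
def barPt (x : R3) : R3 := mk3 (x 0) (-(x 1)) (-(x 2))

/-- partial derivative ∂f/∂xᵢ -/
def pd (i : Fin 3) (f : R3 → QH) (x : R3) : QH :=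
  fderiv ℝ f x (EuclideanSpace.single i 1)

/-- the generalized Cauchy-Riemann operator ∂̄f = ∂f/∂x₀ + e₁∂f/∂x₁ + e₂∂f/∂x₂ -/
def CRbar (f : R3 → QH) (x : R3) : QH :=
  pd 0 f x + e1 * pd 1 f x + e2 * pd 2 f x

/-- the adjoint generalized Cauchy-Riemann operator ∂f = ∂f/∂x₀ - e₁∂f/∂x₁ - e₂∂f/∂x₂ -/
def Dadj (f : R3 → QH) (x : R3) : QH :=
  pd 0 f x - e1 * pd 1 f x - e2 * pd 2 f x

/-- the hypercomplex derivative ∂₀ = (1/2)∂ -/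
def D0 (f : R3 → QH) : R3 → QH := fun x =>
  (1/2 : ℝ) • (pd 0 f x - e1 * pd 1 f x - e2 * pd 2 f x)

/-- the operator ∂̄_ℂ f = (1/2)(∂f/∂x₁ + e₃∂f/∂x₂) -/
def DbarC (f : R3 → QH) : R3 → QH := fun x =>
  (1/2 : ℝ) • (pd 1 f x + e3 * pd 2 f x)

/-- the involution f⁰ + f¹e₁ + f²e₂ + f³e₃ ↦ f⁰ - f¹e₁ - f²e₂ + f³e₃ -/
def invol (a : QH) : QH := ⟨a.re, -a.imI, -a.imJ, a.imK⟩

/-- the inner Appell polynomial A_n^l -/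
def appell (n l : ℕ) (x : R3) : QH :=
  ((n.factorial * l.factorial : ℝ) /
      (2 ^ (2 * (n - l)) * (n + l + 1).factorial * (2 * l).factorial)) •
    ((∑ h ∈ Finset.range (n - l + 1),
        (((2 * n - 2 * h + 1).factorial * (2 * l + 2 * h).factorial : ℝ) /
            (h.factorial * (n - l - h).factorial * (n - h).factorial * (l + h).factorial)) •
          (toQbar x ^ h * toQ x ^ (n - l - h))) * zeta x ^ l)

/-- the Kelvin transform K(P)(x) = (x̄/|x|³)·P(x̄/|x|²) -/
def kelvin (P : R3 → QH) (x : R3) : QH :=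
  ((‖x‖ ^ 3)⁻¹ • toQbar x) * P ((‖x‖ ^ 2)⁻¹ • barPt x)

/-- the outer Appell function A_{-(n+2)}^l -/
def outerAppell (n l : ℕ) (x : R3) : QH :=
  (((n + l + 1).factorial * (n - l).factorial : ℝ) / (n.factorial * (n + 1).factorial)) •
    kelvin (appell n l) x

/-- surface integral over the sphere of radius ρ (parametrized by the unit sphere
with its surface measure, with the Jacobian factor ρ²) -/
def sphereIntegral (ρ : ℝ) (g : R3 → QH) : QH :=
  ∫ ω : sphere (0 : R3) 1, (ρ ^ 2) • g (ρ • (ω : R3)) ∂((volume : Measure R3).toSphere)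

/-- the unified family ψ_k^l, k ∈ ℤ \ {-1}: inner Appell polynomials for k ≥ 0,
outer Appell functions for k ≤ -2 -/
def psiFam (k : ℤ) (l : ℕ) (x : R3) : QH :=
  if 0 ≤ k then appell k.toNat l x else outerAppell (-k - 2).toNat l x

section RadialCutoffs

lemma mem_ball_of_half_norm_sq_lt {R : ℝ} (hR : 0 < R) {y : R3} (hy : ‖y‖ ^ 2 / 2 < R ^ 2 / 2) :
    y ∈ ball (0 : R3) R := by
  rw [mem_ball_zero_iff]
  exact lt_of_pow_lt_pow_left₀ 2 hR.le (by linarith)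

lemma continuous_half_norm_sq : Continuous fun y : R3 => ‖y‖ ^ 2 / 2 := by fun_prop

lemma contDiff_half_norm_sq {k : WithTop ℕ∞} : ContDiff ℝ k fun y : R3 => ‖y‖ ^ 2 / 2 :=
  (contDiff_norm_sq ℝ).div_const 2

/-- Multiplying by a radial cutoff extends regularity from the ball to the whole space. -/
lemma contDiff_radial_smul {E : Type*} [NormedAddCommGroup E] [NormedSpace ℝ E]
    {k : WithTop ℕ∞} {R b : ℝ} (hR : 0 < R) (hb : b < R ^ 2 / 2) {F : ℝ → ℝ}
    (hF : ContDiff ℝ k F) (hF0 : ∀ t, b ≤ t → F t = 0) {u : R3 → E}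
    (hu : ContDiffOn ℝ k u (ball 0 R)) : ContDiff ℝ k fun y => F (‖y‖ ^ 2 / 2) • u y := by
  rw [contDiff_iff_contDiffAt]
  intro x
  by_cases hx : ‖x‖ ^ 2 / 2 < R ^ 2 / 2
  · have hxR := mem_ball_of_half_norm_sq_lt hR hx
    exact (hF.comp contDiff_half_norm_sq).contDiffAt.smul
      (hu.contDiffAt (isOpen_ball.mem_nhds hxR))
  · have hlt : b < ‖x‖ ^ 2 / 2 := by linarith
    refine (contDiffAt_const (c := (0 : E))).congr_of_eventuallyEq ?_
    filter_upwards [continuous_half_norm_sq.continuousAt.eventually (lt_mem_nhds hlt)] with y hy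
    rw [hF0 _ hy.le, zero_smul]

lemma continuous_radial_smul {E : Type*} [NormedAddCommGroup E] [NormedSpace ℝ E]
    {R b : ℝ} (hR : 0 < R) (hb : b < R ^ 2 / 2) {F : ℝ → ℝ}
    (hF : Continuous F) (hF0 : ∀ t, b ≤ t → F t = 0) {u : R3 → E}
    (hu : ContinuousOn u (ball 0 R)) : Continuous fun y => F (‖y‖ ^ 2 / 2) • u y :=
  (contDiff_radial_smul hR hb (contDiff_zero.2 hF) hF0 (contDiffOn_zero.2 hu)).continuous

lemma hasCompactSupport_radial_smul {E : Type*} [NormedAddCommGroup E] [NormedSpace ℝ E]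
    {b : ℝ} {F : ℝ → ℝ} (hF0 : ∀ t, b ≤ t → F t = 0) (u : R3 → E) :
    HasCompactSupport fun y => F (‖y‖ ^ 2 / 2) • u y := by
  refine HasCompactSupport.intro (isCompact_closedBall (0 : R3) (|b| + 2)) fun y hy => ?_
  rw [mem_closedBall_zero_iff, not_le] at hy
  rw [hF0, zero_smul]
  have := le_abs_self b
  have := abs_nonneg b
  nlinarith

lemma integrable_radial_smul {E : Type*} [NormedAddCommGroup E] [NormedSpace ℝ E]
    {R b : ℝ} (hR : 0 < R) (hb : b < R ^ 2 / 2) {F : ℝ → ℝ}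
    (hF : Continuous F) (hF0 : ∀ t, b ≤ t → F t = 0) {u : R3 → E}
    (hu : ContinuousOn u (ball 0 R)) : Integrable fun y => F (‖y‖ ^ 2 / 2) • u y :=
  (continuous_radial_smul hR hb hF hF0 hu).integrable_of_hasCompactSupport
    (hasCompactSupport_radial_smul hF0 u)

/-- Two functions agreeing on the ball have the same radially weighted integrals. -/
lemma integral_radial_congr {E : Type*} [NormedAddCommGroup E] [NormedSpace ℝ E]
    {R b : ℝ} (hR : 0 < R) (hb : b < R ^ 2 / 2) {F : ℝ → ℝ} (hF0 : ∀ t, b ≤ t → F t = 0)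
    {u v : R3 → E} (huv : ∀ y ∈ ball (0 : R3) R, u y = v y) :
    ∫ y, F (‖y‖ ^ 2 / 2) • u y = ∫ y, F (‖y‖ ^ 2 / 2) • v y := by
  refine integral_congr_ae (Filter.Eventually.of_forall fun y => ?_)
  dsimp only
  by_cases hy : ‖y‖ ^ 2 / 2 < R ^ 2 / 2
  · rw [huv y (mem_ball_of_half_norm_sq_lt hR hy)]
  · rw [hF0 _ (by linarith), zero_smul, zero_smul]

end RadialCutoffs

section IntegrationByParts

lemma integral_pd_eq_zero {u : R3 → QH} (hu : ContDiff ℝ 1 u) (hc : HasCompactSupport u)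
    (i : Fin 3) : ∫ y, pd i u y = 0 := by
  have hcont : Continuous fun y => fderiv ℝ u y (EuclideanSpace.single i 1) :=
    (hu.continuous_fderiv one_ne_zero).clm_apply continuous_const
  have hint : Integrable fun y => fderiv ℝ u y (EuclideanSpace.single i 1) :=
    hcont.integrable_of_hasCompactSupport (hc.fderiv_apply ℝ _)
  have := integral_smul_fderiv_eq_neg_fderiv_smul_of_integrable (μ := (volume : Measure R3))
    (f := fun _ : R3 => (1 : ℝ)) (g := u) (v := EuclideanSpace.single i 1) (by simp)
    (by simpa using hint) (by simpa using hu.continuous.integrable_of_hasCompactSupport hc)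
    (fun _ _ => differentiableAt_const _) (fun x _ => (hu.differentiable one_ne_zero) x)
  simpa [pd] using this

lemma hasFDerivAt_half_norm_sq (y : R3) :
    HasFDerivAt (fun y : R3 => ‖y‖ ^ 2 / 2) (innerSL ℝ y) y := by
  have := (hasStrictFDerivAt_norm_sq y).hasFDerivAt.mul_const (1 / 2 : ℝ)
  simp only [mul_one_div] at this
  refine this.congr_fderiv ?_
  ext v
  simp

lemma pd_radial_smul {F : ℝ → ℝ} {F' : ℝ} {u : R3 → QH} {y : R3}
    (hF : HasDerivAt F F' (‖y‖ ^ 2 / 2)) (hu : DifferentiableAt ℝ u y) (i : Fin 3) :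
    pd i (fun y => F (‖y‖ ^ 2 / 2) • u y) y =
      (F' * y i) • u y + F (‖y‖ ^ 2 / 2) • pd i u y := by
  have h1 : HasFDerivAt (fun y : R3 => F (‖y‖ ^ 2 / 2)) (F' • innerSL ℝ y) y :=
    hF.comp_hasFDerivAt y (hasFDerivAt_half_norm_sq y)
  rw [pd, (h1.fun_smul hu.hasFDerivAt).fderiv]
  simp [pd, EuclideanSpace.inner_single_right, add_comm]

lemma continuousOn_pd {u : R3 → QH} {s : Set R3} (hs : IsOpen s) (hu : ContDiffOn ℝ 1 u s)
    (i : Fin 3) : ContinuousOn (pd i u) s :=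
  (hu.continuousOn_fderiv_of_isOpen hs le_rfl).clm_apply continuousOn_const

/-- Integration by parts against a radial cutoff. -/
lemma integral_radial_mul_coord {R b : ℝ} (hR : 0 < R) (hb : b < R ^ 2 / 2) {F F' : ℝ → ℝ}
    (hF : ∀ t, HasDerivAt F (F' t) t) (hF' : Continuous F') (hF0 : ∀ t, b ≤ t → F t = 0)
    (hF'0 : ∀ t, b ≤ t → F' t = 0) {u : R3 → QH} (hu : ContDiffOn ℝ 1 u (ball 0 R)) (i : Fin 3) :
    ∫ y, F' (‖y‖ ^ 2 / 2) • (y i • u y) = - ∫ y, F (‖y‖ ^ 2 / 2) • pd i u y := by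
  have hFd : Differentiable ℝ F := fun t => (hF t).differentiableAt
  have hFc : ContDiff ℝ 1 F := by
    rw [contDiff_one_iff_deriv]
    exact ⟨hFd, by rwa [show deriv F = F' from funext fun t => (hF t).deriv]⟩
  have key : ∀ y, pd i (fun y => F (‖y‖ ^ 2 / 2) • u y) y =
      F' (‖y‖ ^ 2 / 2) • (y i • u y) + F (‖y‖ ^ 2 / 2) • pd i u y := by
    intro y
    by_cases hy : ‖y‖ ^ 2 / 2 < R ^ 2 / 2
    · rw [smul_smul]
      exact pd_radial_smul (hF _) ((hu.differentiableOn one_ne_zero).differentiableAt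
        (isOpen_ball.mem_nhds (mem_ball_of_half_norm_sq_lt hR hy))) i
    · have hlt : b < ‖y‖ ^ 2 / 2 := by linarith
      rw [hF0 _ hlt.le, hF'0 _ hlt.le, zero_smul, zero_smul, add_zero, pd]
      rw [Filter.EventuallyEq.fderiv_eq (f := fun _ => (0 : QH))]
      · simp
      filter_upwards [continuous_half_norm_sq.continuousAt.eventually (lt_mem_nhds hlt)] with z hz
      rw [hF0 _ hz.le, zero_smul]
  have h0 := integral_pd_eq_zero (contDiff_radial_smul hR hb hFc hF0 hu)
    (hasCompactSupport_radial_smul hF0 u) i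
  simp_rw [key] at h0
  rw [integral_add] at h0
  · exact eq_neg_of_add_eq_zero_left h0
  · exact integrable_radial_smul hR hb hF' hF'0
      ((by fun_prop : Continuous fun y : R3 => y i).continuousOn.smul hu.continuousOn)
  · exact integrable_radial_smul hR hb hFd.continuous hF0 (continuousOn_pd isOpen_ball hu i)

/-- A continuous function vanishing on `[b, ∞)` has a primitive vanishing there. -/
lemma exists_primitive_vanishing {G : ℝ → ℝ} (hG : Continuous G) {b : ℝ}
    (hG0 : ∀ t, b ≤ t → G t = 0) :
    ∃ K : ℝ → ℝ, (∀ t, HasDerivAt K (G t) t) ∧ ∀ t, b ≤ t → K t = 0 := by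
  refine ⟨fun t => ∫ s in b..t, G s, fun t => hG.integral_hasStrictDerivAt b t |>.hasDerivAt,
    fun t ht => ?_⟩
  dsimp only
  rw [intervalIntegral.integral_congr (g := fun _ => (0 : ℝ))]
  · simp
  · intro s hs
    rw [Set.uIcc_of_le ht] at hs
    exact hG0 s hs.1

end IntegrationByParts

section Components

@[simp] lemma e1_re : e1.re = 0 := rfl
@[simp] lemma e1_imI : e1.imI = 1 := rfl
@[simp] lemma e1_imJ : e1.imJ = 0 := rfl
@[simp] lemma e1_imK : e1.imK = 0 := rfl

@[simp] lemma e2_re : e2.re = 0 := rfl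
@[simp] lemma e2_imI : e2.imI = 0 := rfl
@[simp] lemma e2_imJ : e2.imJ = 1 := rfl
@[simp] lemma e2_imK : e2.imK = 0 := rfl

@[simp] lemma e3_re : e3.re = 0 := rfl
@[simp] lemma e3_imI : e3.imI = 0 := rfl
@[simp] lemma e3_imJ : e3.imJ = 0 := rfl
@[simp] lemma e3_imK : e3.imK = 1 := rfl

@[simp] lemma toQ_re (x : R3) : (toQ x).re = x 0 := rfl
@[simp] lemma toQ_imI (x : R3) : (toQ x).imI = x 1 := rfl
@[simp] lemma toQ_imJ (x : R3) : (toQ x).imJ = x 2 := rfl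
@[simp] lemma toQ_imK (x : R3) : (toQ x).imK = 0 := rfl

@[simp] lemma toQbar_re (x : R3) : (toQbar x).re = x 0 := rfl
@[simp] lemma toQbar_imI (x : R3) : (toQbar x).imI = -x 1 := rfl
@[simp] lemma toQbar_imJ (x : R3) : (toQbar x).imJ = -x 2 := rfl
@[simp] lemma toQbar_imK (x : R3) : (toQbar x).imK = 0 := rfl

@[simp] lemma zeta_re (x : R3) : (zeta x).re = x 1 := rfl
@[simp] lemma zeta_imI (x : R3) : (zeta x).imI = 0 := rfl
@[simp] lemma zeta_imJ (x : R3) : (zeta x).imJ = 0 := rfl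
@[simp] lemma zeta_imK (x : R3) : (zeta x).imK = -x 2 := rfl

end Components

section PartialDerivatives

lemma pd_add {f g : R3 → QH} {x : R3} (hf : DifferentiableAt ℝ f x) (hg : DifferentiableAt ℝ g x)
    (i : Fin 3) : pd i (fun y => f y + g y) x = pd i f x + pd i g x := by
  rw [pd, fderiv_fun_add hf hg]
  rfl

lemma pd_const_smul {f : R3 → QH} {x : R3} (hf : DifferentiableAt ℝ f x) (c : ℝ) (i : Fin 3) :
    pd i (fun y => c • f y) x = c • pd i f x := by
  rw [pd, fderiv_fun_const_smul hf]
  rfl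

lemma pd_mul {f g : R3 → QH} {x : R3} (hf : DifferentiableAt ℝ f x) (hg : DifferentiableAt ℝ g x)
    (i : Fin 3) : pd i (fun y => f y * g y) x = pd i f x * g x + f x * pd i g x := by
  rw [pd, fderiv_fun_mul' hf hg]
  simp [pd, add_comm]

lemma pd_const_mul {f : R3 → QH} {x : R3} (hf : DifferentiableAt ℝ f x) (c : QH) (i : Fin 3) :
    pd i (fun y => c * f y) x = c * pd i f x := by
  rw [pd_mul (differentiableAt_const c) hf]
  simp [pd]

/-- Quaternion conjugation as a real linear map. -/
def starLin : QH →ₗ[ℝ] QH where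
  toFun := star
  map_add' := star_add
  map_smul' c a := by ext <;> simp

lemma contDiff_star {k : WithTop ℕ∞} : ContDiff ℝ k (star : QH → QH) :=
  starLin.toContinuousLinearMap.contDiff

lemma pd_star {f : R3 → QH} {x : R3} (hf : DifferentiableAt ℝ f x) (i : Fin 3) :
    pd i (fun y => star (f y)) x = star (pd i f x) := by
  have h : HasFDerivAt (fun y => star (f y)) (starLin.toContinuousLinearMap.comp (fderiv ℝ f x)) x :=
    starLin.toContinuousLinearMap.hasFDerivAt.comp x hf.hasFDerivAt
  rw [pd, h.fderiv]
  rfl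

lemma pd_coord_smul {f : R3 → QH} {x : R3} (hf : DifferentiableAt ℝ f x) (i j : Fin 3) :
    pd i (fun y => y j • f y) x = (if j = i then f x else 0) + x j • pd i f x := by
  have h1 : HasFDerivAt (fun y : R3 => y j) (EuclideanSpace.proj j : R3 →L[ℝ] ℝ) x :=
    (EuclideanSpace.proj j : R3 →L[ℝ] ℝ).hasFDerivAt
  rw [pd, (h1.fun_smul hf.hasFDerivAt).fderiv]
  simp [pd, add_comm]

lemma fderiv_self_eq_sum (f : R3 → QH) (x y : R3) :
    fderiv ℝ f x y = ∑ i, y i • pd i f x := by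
  have h : y = ∑ i, y i • EuclideanSpace.single i (1 : ℝ) := by
    ext j
    simp [Pi.single_apply]
  conv_lhs => rw [h]
  simp [pd]

lemma pd_comm {f : R3 → QH} {s : Set R3} (hs : IsOpen s) (hf : ContDiffOn ℝ 2 f s) {x : R3}
    (hx : x ∈ s) (i j : Fin 3) : pd i (pd j f) x = pd j (pd i f) x := by
  have hfx : ContDiffAt ℝ 2 f x := hf.contDiffAt (hs.mem_nhds hx)
  have hd : DifferentiableAt ℝ (fderiv ℝ f) x :=
    (hfx.fderiv_right (m := 1) (by norm_num)).differentiableAt one_ne_zero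
  have key : ∀ v w : R3, fderiv ℝ (fun y => fderiv ℝ f y v) x w = fderiv ℝ (fderiv ℝ f) x w v := by
    intro v w
    rw [fderiv_clm_apply hd (differentiableAt_const v)]
    simp
  have hsymm : IsSymmSndFDerivAt ℝ f x := hfx.isSymmSndFDerivAt (by simp)
  change fderiv ℝ (fun y => fderiv ℝ f y _) x _ = fderiv ℝ (fun y => fderiv ℝ f y _) x _
  rw [key, key, hsymm.eq]

lemma contDiffOn_pd {f : R3 → QH} {s : Set R3} (hs : IsOpen s) {k m : WithTop ℕ∞}
    (hf : ContDiffOn ℝ k f s) (hkm : m + 1 ≤ k) (i : Fin 3) : ContDiffOn ℝ m (pd i f) s :=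
  (hf.fderiv_of_isOpen hs hkm).clm_apply contDiffOn_const

/-- `toQ` as a linear map. -/
def toQLin : R3 →ₗ[ℝ] QH where
  toFun := toQ
  map_add' x y := by ext <;> simp
  map_smul' c x := by ext <;> simp

/-- `toQbar` as a linear map. -/
def toQbarLin : R3 →ₗ[ℝ] QH where
  toFun := toQbar
  map_add' x y := by ext <;> simp <;> ring
  map_smul' c x := by ext <;> simp

/-- `zeta` as a linear map. -/
def zetaLin : R3 →ₗ[ℝ] QH where
  toFun := zeta
  map_add' x y := by ext <;> simp <;> ring
  map_smul' c x := by ext <;> simp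

lemma contDiff_toQ {k : WithTop ℕ∞} : ContDiff ℝ k toQ := toQLin.toContinuousLinearMap.contDiff

lemma contDiff_toQbar {k : WithTop ℕ∞} : ContDiff ℝ k toQbar :=
  toQbarLin.toContinuousLinearMap.contDiff

lemma contDiff_zeta {k : WithTop ℕ∞} : ContDiff ℝ k zeta := zetaLin.toContinuousLinearMap.contDiff

lemma pd_toQ (i : Fin 3) (x : R3) : pd i toQ x = toQ (EuclideanSpace.single i 1) :=
  congrArg (· (EuclideanSpace.single i 1)) toQLin.toContinuousLinearMap.fderiv

lemma pd_toQbar (i : Fin 3) (x : R3) : pd i toQbar x = toQbar (EuclideanSpace.single i 1) :=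
  congrArg (· (EuclideanSpace.single i 1)) toQbarLin.toContinuousLinearMap.fderiv

lemma pd_zeta (i : Fin 3) (x : R3) : pd i zeta x = zeta (EuclideanSpace.single i 1) :=
  congrArg (· (EuclideanSpace.single i 1)) zetaLin.toContinuousLinearMap.fderiv

lemma commute_zeta (x y : R3) : Commute (zeta x) (zeta y) := by
  ext <;> simp <;> ring

lemma pd_zeta_pow (l : ℕ) (i : Fin 3) (x : R3) :
    pd i (fun y => zeta y ^ l) x =
      (l : ℝ) • (zeta (EuclideanSpace.single i 1) * zeta x ^ (l - 1)) := by
  induction l with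
  | zero => simp [pd]
  | succ l ih =>
    simp_rw [pow_succ']
    rw [pd_mul (contDiff_zeta.differentiable one_ne_zero _)
      ((contDiff_zeta.pow l).differentiable one_ne_zero _), ih, pd_zeta]
    rcases l with _ | l
    · simp
    · rw [mul_smul_comm, ← mul_assoc, (commute_zeta x _).eq, mul_assoc, Nat.add_sub_cancel,
        ← pow_succ', Nat.add_sub_cancel]
      push_cast
      module

end PartialDerivatives

section CauchyRiemann

/-- The Euler operator `∑ xᵢ ∂ᵢ`. -/
def euler (f : R3 → QH) (x : R3) : QH := ∑ i, x i • pd i f x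

lemma CRbar_toQ_mul {P : R3 → QH} {x : R3} (hP : DifferentiableAt ℝ P x) :
    CRbar (fun y => toQ y * P y) x =
      toQbar x * CRbar P x + (2 : ℝ) • (toQ x * pd 0 P x) - P x - (2 : ℝ) • euler P x := by
  simp only [CRbar, pd_mul (contDiff_toQ.differentiable one_ne_zero x) hP, pd_toQ, euler,
    Fin.sum_univ_three]
  ext <;> simp <;> ring

lemma CRbar_toQbar_mul {P : R3 → QH} {x : R3} (hP : DifferentiableAt ℝ P x) :
    CRbar (fun y => toQbar y * P y) x =
      (3 : ℝ) • P x + (2 : ℝ) • euler P x - toQ x * Dadj P x := by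
  simp only [CRbar, Dadj, pd_mul (contDiff_toQbar.differentiable one_ne_zero x) hP, pd_toQbar, euler,
    Fin.sum_univ_three]
  ext <;> simp <;> ring

lemma Dadj_toQbar_mul {P : R3 → QH} {x : R3} (hP : DifferentiableAt ℝ P x) :
    Dadj (fun y => toQbar y * P y) x =
      toQ x * Dadj P x + (2 : ℝ) • (toQbar x * pd 0 P x) - P x - (2 : ℝ) • euler P x := by
  simp only [Dadj, pd_mul (contDiff_toQbar.differentiable one_ne_zero x) hP, pd_toQbar, euler,
    Fin.sum_univ_three]
  ext <;> simp <;> ring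

lemma Dadj_toQ_mul {P : R3 → QH} {x : R3} (hP : DifferentiableAt ℝ P x) :
    Dadj (fun y => toQ y * P y) x =
      (3 : ℝ) • P x + (2 : ℝ) • euler P x - toQbar x * CRbar P x := by
  simp only [CRbar, Dadj, pd_mul (contDiff_toQ.differentiable one_ne_zero x) hP, pd_toQ, euler,
    Fin.sum_univ_three]
  ext <;> simp <;> ring

lemma euler_linear_mul (L : R3 →ₗ[ℝ] QH) {P : R3 → QH} {x : R3} (hP : DifferentiableAt ℝ P x) :
    euler (fun y => L y * P y) x = L x * P x + L x * euler P x := by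
  have hL : HasFDerivAt (fun y => L y) L.toContinuousLinearMap x :=
    L.toContinuousLinearMap.hasFDerivAt
  have h1 : ∀ i, pd i (fun y => L y) x = L (EuclideanSpace.single i 1) := fun i => by
    rw [pd, hL.fderiv]
    rfl
  simp only [euler, pd_mul hL.differentiableAt hP, smul_add, sum_add_distrib, mul_sum, h1]
  congr 1
  · simp only [← smul_mul_assoc, ← sum_mul, ← map_smul, ← map_sum]
    congr 2
    ext j
    simp [Pi.single_apply]
  · simp

end CauchyRiemann

section AppellPairs

lemma pd_linear_comb {f g : R3 → QH} {x : R3} (hf : DifferentiableAt ℝ f x)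
    (hg : DifferentiableAt ℝ g x) (a b : ℝ) (i : Fin 3) :
    pd i (fun y => a • f y + b • g y) x = a • pd i f x + b • pd i g x := by
  rw [pd_add (f := fun y => a • f y) (g := fun y => b • g y) (hf.const_smul a) (hg.const_smul b),
    pd_const_smul hf, pd_const_smul hg]

lemma CRbar_linear_comb {f g : R3 → QH} {x : R3} (hf : DifferentiableAt ℝ f x)
    (hg : DifferentiableAt ℝ g x) (a b : ℝ) :
    CRbar (fun y => a • f y + b • g y) x = a • CRbar f x + b • CRbar g x := by
  simp only [CRbar, pd_linear_comb hf hg, mul_add, mul_smul_comm]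
  module

lemma Dadj_linear_comb {f g : R3 → QH} {x : R3} (hf : DifferentiableAt ℝ f x)
    (hg : DifferentiableAt ℝ g x) (a b : ℝ) :
    Dadj (fun y => a • f y + b • g y) x = a • Dadj f x + b • Dadj g x := by
  simp only [Dadj, pd_linear_comb hf hg, mul_add, mul_smul_comm]
  module

lemma euler_linear_comb {f g : R3 → QH} {x : R3} (hf : DifferentiableAt ℝ f x)
    (hg : DifferentiableAt ℝ g x) (a b : ℝ) :
    euler (fun y => a • f y + b • g y) x = a • euler f x + b • euler g x := by
  simp only [euler, pd_linear_comb hf hg, Fin.sum_univ_three]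
  module

/-- The inner Appell polynomial of degree `m + l` up to normalization, paired with its
companion annihilated by the adjoint Cauchy-Riemann operator. -/
def appellPair (l : ℕ) : ℕ → (R3 → QH) × (R3 → QH)
  | 0 => (fun x => zeta x ^ l, fun x => zeta x ^ l)
  | m + 1 =>
    (fun x => ((l + 1 / 2 + m + 1 : ℝ) / (m + 1)) • (toQ x * (appellPair l m).1 x) +
        ((l + 1 / 2 : ℝ) / (m + 1)) • (toQbar x * (appellPair l m).2 x),
      fun x => ((l + 1 / 2 + m + 1 : ℝ) / (m + 1)) • (toQbar x * (appellPair l m).2 x) +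
        ((l + 1 / 2 : ℝ) / (m + 1)) • (toQ x * (appellPair l m).1 x))

/-- The differential relations satisfied by `appellPair l m`. -/
structure IsAppellPair (l m : ℕ) (P Q : R3 → QH) : Prop where
  contDiff_fst : ContDiff ℝ 1 P
  contDiff_snd : ContDiff ℝ 1 Q
  CRbar_fst : ∀ x, CRbar P x = 0
  Dadj_snd : ∀ x, Dadj Q x = 0
  euler_fst : ∀ x, euler P x = (m + l : ℝ) • P x
  euler_snd : ∀ x, euler Q x = (m + l : ℝ) • Q x
  toQ_mul_pd : ∀ x, toQ x * pd 0 P x = (l + 1 / 2 + m : ℝ) • P x - (l + 1 / 2 : ℝ) • Q x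
  toQbar_mul_pd : ∀ x, toQbar x * pd 0 Q x = (l + 1 / 2 + m : ℝ) • Q x - (l + 1 / 2 : ℝ) • P x

lemma pd_zero_zeta_pow (l : ℕ) (x : R3) : pd 0 (fun y => zeta y ^ l) x = 0 := by
  rw [pd_zeta_pow]
  have : zeta (EuclideanSpace.single 0 1) = 0 := by ext <;> simp <;> rfl
  simp [this]

lemma e1_mul_pd_zeta_pow_add (l : ℕ) (x : R3) :
    e1 * pd 1 (fun y => zeta y ^ l) x + e2 * pd 2 (fun y => zeta y ^ l) x = 0 := by
  rw [pd_zeta_pow, pd_zeta_pow, add_eq_zero_iff_eq_neg]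
  ext <;> simp

lemma euler_zeta_pow (l : ℕ) (x : R3) : euler (fun y => zeta y ^ l) x = (l : ℝ) • zeta x ^ l := by
  induction l with
  | zero => simp [euler, pd]
  | succ l ih =>
    have := euler_linear_mul zetaLin (P := fun y => zeta y ^ l) (x := x)
      ((contDiff_zeta.pow l).differentiable one_ne_zero x)
    simp_rw [pow_succ']
    refine this.trans ?_
    rw [ih, mul_smul_comm]
    change zeta x * _ + (l : ℝ) • (zeta x * _) = _
    push_cast
    module

lemma isAppellPair_zeta_pow (l : ℕ) :
    IsAppellPair l 0 (fun x => zeta x ^ l) (fun x => zeta x ^ l) := by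
  refine ⟨contDiff_zeta.pow l, contDiff_zeta.pow l, fun x => ?_, fun x => ?_, fun x => ?_,
    fun x => ?_, fun x => ?_, fun x => ?_⟩
  · rw [CRbar, pd_zero_zeta_pow, zero_add, e1_mul_pd_zeta_pow_add]
  · rw [Dadj, pd_zero_zeta_pow, sub_sub, e1_mul_pd_zeta_pow_add, sub_zero]
  · simp [euler_zeta_pow]
  · simp [euler_zeta_pow]
  · simp [pd_zero_zeta_pow]
  · simp [pd_zero_zeta_pow]

lemma IsAppellPair.succ {l m : ℕ} {P Q : R3 → QH} (h : IsAppellPair l m P Q) :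
    IsAppellPair l (m + 1)
      (fun x => ((l + 1 / 2 + m + 1 : ℝ) / (m + 1)) • (toQ x * P x) +
        ((l + 1 / 2 : ℝ) / (m + 1)) • (toQbar x * Q x))
      (fun x => ((l + 1 / 2 + m + 1 : ℝ) / (m + 1)) • (toQbar x * Q x) +
        ((l + 1 / 2 : ℝ) / (m + 1)) • (toQ x * P x)) := by
  obtain ⟨hP, hQ, hCR, hD, hEP, hEQ, hsP, hsQ⟩ := h
  have hm : (m + 1 : ℝ) ≠ 0 := by positivity
  have hxP : ContDiff ℝ 1 fun x => toQ x * P x := contDiff_toQ.mul hP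
  have hxQ : ContDiff ℝ 1 fun x => toQbar x * Q x := contDiff_toQbar.mul hQ
  have dP := hP.differentiable one_ne_zero
  have dQ := hQ.differentiable one_ne_zero
  have dxP := hxP.differentiable one_ne_zero
  have dxQ := hxQ.differentiable one_ne_zero
  have tQ : toQ (EuclideanSpace.single 0 1) = 1 := by ext <;> simp <;> rfl
  have tQbar : toQbar (EuclideanSpace.single 0 1) = 1 := by ext <;> simp <;> rfl
  have pxP : ∀ x, pd 0 (fun x => toQ x * P x) x =
      (l + 1 / 2 + m + 1 : ℝ) • P x - (l + 1 / 2 : ℝ) • Q x := fun x => by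
    rw [pd_mul (contDiff_toQ.differentiable one_ne_zero x) (dP x), pd_toQ, hsP, tQ, one_mul]
    module
  have pxQ : ∀ x, pd 0 (fun x => toQbar x * Q x) x =
      (l + 1 / 2 + m + 1 : ℝ) • Q x - (l + 1 / 2 : ℝ) • P x := fun x => by
    rw [pd_mul (contDiff_toQbar.differentiable one_ne_zero x) (dQ x), pd_toQbar, hsQ, tQbar,
      one_mul]
    module
  have eP : ∀ x, euler (fun x => toQ x * P x) x = (m + 1 + l : ℝ) • (toQ x * P x) := fun x => by
    refine (euler_linear_mul toQLin (dP x)).trans ?_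
    rw [hEP, mul_smul_comm]
    change toQ x * _ + (m + l : ℝ) • (toQ x * _) = _
    module
  have eQ : ∀ x, euler (fun x => toQbar x * Q x) x = (m + 1 + l : ℝ) • (toQbar x * Q x) :=
    fun x => by
    refine (euler_linear_mul toQbarLin (dQ x)).trans ?_
    rw [hEQ, mul_smul_comm]
    change toQbar x * _ + (m + l : ℝ) • (toQbar x * _) = _
    module
  refine ⟨(hxP.const_smul _).add (hxQ.const_smul _), (hxQ.const_smul _).add (hxP.const_smul _),
    fun x => ?_, fun x => ?_, fun x => ?_, fun x => ?_, fun x => ?_, fun x => ?_⟩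
  · rw [CRbar_linear_comb (dxP x) (dxQ x), CRbar_toQ_mul (dP x), CRbar_toQbar_mul (dQ x),
      hCR, hD, hsP, hEP, hEQ, mul_zero, mul_zero]
    match_scalars <;> field_simp <;> ring
  · rw [Dadj_linear_comb (dxQ x) (dxP x), Dadj_toQ_mul (dP x), Dadj_toQbar_mul (dQ x),
      hCR, hD, hsQ, hEP, hEQ, mul_zero, mul_zero]
    match_scalars <;> field_simp <;> ring
  · rw [euler_linear_comb (dxP x) (dxQ x), eP, eQ]
    push_cast
    module
  · rw [euler_linear_comb (dxQ x) (dxP x), eP, eQ]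
    push_cast
    module
  · rw [pd_linear_comb (dxP x) (dxQ x), pxP, pxQ, mul_add, mul_smul_comm, mul_smul_comm, mul_sub,
      mul_sub, mul_smul_comm, mul_smul_comm, mul_smul_comm, mul_smul_comm]
    push_cast
    match_scalars <;> field_simp <;> ring
  · rw [pd_linear_comb (dxQ x) (dxP x), pxP, pxQ, mul_add, mul_smul_comm, mul_smul_comm, mul_sub,
      mul_sub, mul_smul_comm, mul_smul_comm, mul_smul_comm, mul_smul_comm]
    push_cast
    match_scalars <;> field_simp <;> ring

lemma isAppellPair_appellPair (l m : ℕ) :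
    IsAppellPair l m (appellPair l m).1 (appellPair l m).2 := by
  induction m with
  | zero => exact isAppellPair_zeta_pow l
  | succ m ih => exact ih.succ

end AppellPairs

section AppellClosedForm

/-- The coefficient `(l + 1/2)_h / h!` of the binomial series. -/
def appellCoeff (l h : ℕ) : ℝ :=
  ((2 * l + 2 * h).factorial * l.factorial) /
    ((2 * l).factorial * (l + h).factorial * h.factorial * 4 ^ h)

lemma appellCoeff_zero (l : ℕ) : appellCoeff l 0 = 1 := by
  have h1 := Nat.factorial_ne_zero l
  have h2 := Nat.factorial_ne_zero (2 * l)
  simp only [appellCoeff, mul_zero, add_zero, Nat.factorial_zero, pow_zero, Nat.cast_one]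
  field_simp

lemma appellCoeff_succ (l h : ℕ) :
    (h + 1 : ℝ) * appellCoeff l (h + 1) = (l + 1 / 2 + h) * appellCoeff l h := by
  have h1 := Nat.factorial_ne_zero l
  have h2 := Nat.factorial_ne_zero (2 * l)
  have h3 := Nat.factorial_ne_zero (l + h)
  have h4 := Nat.factorial_ne_zero h
  have h5 : (l + h + 1 : ℝ) ≠ 0 := by positivity
  have h6 : (h + 1 : ℝ) ≠ 0 := by positivity
  rw [appellCoeff, appellCoeff, show 2 * l + 2 * (h + 1) = 2 * l + 2 * h + 1 + 1 by ring,
    show l + (h + 1) = l + h + 1 by ring]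
  simp only [Nat.factorial_succ]
  push_cast
  field_simp
  ring

lemma commute_toQ_toQbar (x : R3) : Commute (toQ x) (toQbar x) := by
  ext <;> simp <;> ring

lemma appellPair_eq_sum (l m : ℕ) (x : R3) :
    (appellPair l m).1 x = (∑ p ∈ antidiagonal m,
        ((l + 1 / 2 + p.2) / (l + 1 / 2) * (appellCoeff l p.1 * appellCoeff l p.2)) •
          (toQbar x ^ p.1 * toQ x ^ p.2)) * zeta x ^ l ∧
      (appellPair l m).2 x = (∑ p ∈ antidiagonal m,
        ((l + 1 / 2 + p.1) / (l + 1 / 2) * (appellCoeff l p.1 * appellCoeff l p.2)) •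
          (toQbar x ^ p.1 * toQ x ^ p.2)) * zeta x ^ l := by
  have hl : (l + 1 / 2 : ℝ) ≠ 0 := by positivity
  induction m with
  | zero => simp [appellPair, appellCoeff_zero]; field_simp; simp
  | succ m ih =>
    obtain ⟨ih1, ih2⟩ := ih
    have hm : (m + 1 : ℝ) ≠ 0 := by positivity
    have hz : toQ x * (appellPair l m).1 x = (∑ p ∈ antidiagonal (m + 1),
        (p.2 / (l + 1 / 2) * (appellCoeff l p.1 * appellCoeff l p.2)) •
          (toQbar x ^ p.1 * toQ x ^ p.2)) * zeta x ^ l := by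
      rw [ih1, Nat.sum_antidiagonal_succ', ← mul_assoc, mul_sum]
      simp only [Nat.cast_zero, zero_div, zero_mul, zero_smul, zero_add]
      congr 1
      refine sum_congr rfl fun p _ => ?_
      rw [mul_smul_comm, ← mul_assoc (toQ x), ((commute_toQ_toQbar x).pow_right p.1).eq, mul_assoc,
        ← pow_succ']
      congr 1
      have := appellCoeff_succ l p.2
      push_cast
      field_simp
      linear_combination (-2 * appellCoeff l p.1) * this
    have hw : toQbar x * (appellPair l m).2 x = (∑ p ∈ antidiagonal (m + 1),
        (p.1 / (l + 1 / 2) * (appellCoeff l p.1 * appellCoeff l p.2)) •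
          (toQbar x ^ p.1 * toQ x ^ p.2)) * zeta x ^ l := by
      rw [ih2, Nat.sum_antidiagonal_succ, ← mul_assoc, mul_sum]
      simp only [Nat.cast_zero, zero_div, zero_mul, zero_smul, zero_add]
      congr 1
      refine sum_congr rfl fun p _ => ?_
      rw [mul_smul_comm, ← mul_assoc (toQbar x), ← pow_succ']
      congr 1
      have := appellCoeff_succ l p.1
      push_cast
      field_simp
      linear_combination (-2 * appellCoeff l p.2) * this
    simp only [appellPair]
    rw [hz, hw, ← smul_mul_assoc, ← smul_mul_assoc, ← smul_mul_assoc, ← smul_mul_assoc, ← add_mul,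
      ← add_mul, smul_sum, smul_sum, smul_sum, smul_sum, ← sum_add_distrib, ← sum_add_distrib]
    constructor
    all_goals
      congr 1
      refine sum_congr rfl fun p hp => ?_
      have hp' : (p.1 + p.2 : ℝ) = m + 1 := by exact_mod_cast mem_antidiagonal.1 hp
      rw [smul_smul, smul_smul, ← add_smul]
      congr 1
      rw [← hp'] at hm
      rw [show (l + 1 / 2 + m + 1 : ℝ) = l + 1 / 2 + (p.1 + p.2) by rw [hp']; ring, ← hp']
      field_simp
      ring

lemma appell_eq_smul_appellPair {n l : ℕ} (hl : l ≤ n) (x : R3) :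
    appell n l x = ((n.factorial * (2 * l + 1).factorial : ℝ) /
      ((n + l + 1).factorial * l.factorial)) • (appellPair l (n - l)).1 x := by
  obtain ⟨m, rfl⟩ := Nat.exists_eq_add_of_le hl
  have h1 := Nat.factorial_ne_zero l
  have h2 := Nat.factorial_ne_zero (2 * l)
  have h3 := Nat.factorial_ne_zero (l + m + l + 1)
  have hl : (2 * l + 1 : ℝ) ≠ 0 := by positivity
  rw [(appellPair_eq_sum l (l + m - l) x).1, appell, Nat.add_sub_cancel_left, ← smul_mul_assoc,
    ← smul_mul_assoc, smul_sum, smul_sum, Nat.sum_antidiagonal_eq_sum_range_succ_mk]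
  congr 1
  refine sum_congr rfl fun h hh => ?_
  obtain ⟨k, rfl⟩ := Nat.exists_eq_add_of_le (Nat.lt_succ_iff.1 (mem_range.1 hh))
  rw [smul_smul, smul_smul]
  dsimp only
  rw [Nat.add_sub_cancel_left, show 2 * (l + (h + k)) - 2 * h + 1 = 2 * l + 2 * k + 1 by omega,
    show l + (h + k) - h = l + k by omega]
  congr 1
  have h4 := Nat.factorial_ne_zero (l + h)
  have h5 := Nat.factorial_ne_zero h
  have h6 := Nat.factorial_ne_zero (l + k)
  have h7 := Nat.factorial_ne_zero k
  rw [appellCoeff, appellCoeff, Nat.factorial_succ (2 * l + 2 * k), Nat.factorial_succ (2 * l),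
    show (2 : ℝ) ^ (2 * (h + k)) = 4 ^ h * 4 ^ k by rw [pow_mul, pow_add]; norm_num]
  push_cast
  field_simp
  ring

end AppellClosedForm

section RadialDivergence

/-- The divergence theorem against a radial cutoff. -/
lemma integral_radial_div {R b : ℝ} (hR : 0 < R) (hb : b < R ^ 2 / 2) {F F' : ℝ → ℝ}
    (hF : ∀ t, HasDerivAt F (F' t) t) (hF' : Continuous F') (hF0 : ∀ t, b ≤ t → F t = 0)
    (hF'0 : ∀ t, b ≤ t → F' t = 0) {u : Fin 3 → R3 → QH}
    (hu : ∀ i, ContDiffOn ℝ 1 (u i) (ball 0 R)) :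
    ∫ y, F' (‖y‖ ^ 2 / 2) • ∑ i, y i • u i y = - ∫ y, F (‖y‖ ^ 2 / 2) • ∑ i, pd i (u i) y := by
  have hFc : Continuous F := continuous_iff_continuousAt.2 fun t => (hF t).continuousAt
  simp_rw [smul_sum]
  rw [integral_finsetSum, integral_finsetSum, ← sum_neg_distrib]
  · exact sum_congr rfl fun i _ => integral_radial_mul_coord hR hb hF hF' hF0 hF'0 (hu i) i
  · exact fun i _ => integrable_radial_smul hR hb hFc hF0 (continuousOn_pd isOpen_ball (hu i) i)
  · exact fun i _ => integrable_radial_smul hR hb hF' hF'0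
      ((by fun_prop : Continuous fun y : R3 => y i).continuousOn.smul (hu i).continuousOn)

/-- Integration by parts for a first order operator `∑ cᵢ ∂ᵢ` whose formal adjoint
annihilates the weight `star B`. -/
lemma integral_radial_star_mul {R b : ℝ} (hR : 0 < R) (hb : b < R ^ 2 / 2) {F F' : ℝ → ℝ}
    (hF : ∀ t, HasDerivAt F (F' t) t) (hF' : Continuous F') (hF0 : ∀ t, b ≤ t → F t = 0)
    (hF'0 : ∀ t, b ≤ t → F' t = 0) {B h : R3 → QH} (c : Fin 3 → QH) (hB : ContDiff ℝ 1 B)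
    (hBc : ∀ x, ∑ i, star (c i) * pd i B x = 0) (hh : ContDiffOn ℝ 1 h (ball 0 R)) :
    ∫ y, F' (‖y‖ ^ 2 / 2) • (star (B y) * ((∑ i, y i • c i) * h y)) =
      - ∫ y, F (‖y‖ ^ 2 / 2) • (star (B y) * ∑ i, c i * pd i h y) := by
  have hsB : ContDiff ℝ 1 fun y => star (B y) := contDiff_star.comp hB
  have hdiv := integral_radial_div hR hb hF hF' hF0 hF'0
    (u := fun i y => star (B y) * (c i * h y))
    (fun i => hsB.contDiffOn.mul (contDiffOn_const.mul hh))
  convert hdiv using 2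
  · funext y
    simp only [mul_sum, sum_mul, smul_mul_assoc, mul_smul_comm]
  · refine integral_radial_congr hR hb hF0 fun y hy => ?_
    have hd : DifferentiableAt ℝ h y :=
      (hh.differentiableOn one_ne_zero).differentiableAt (isOpen_ball.mem_nhds hy)
    have h1 : ∀ i, pd i (fun y => star (B y) * (c i * h y)) y =
        star (star (c i) * pd i B y) * h y + star (B y) * (c i * pd i h y) := fun i => by
      rw [pd_mul (hsB.differentiable one_ne_zero y) (hd.const_mul (c i)),
        pd_star (hB.differentiable one_ne_zero y), pd_const_mul hd, star_mul, star_star, mul_assoc]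
    simp only [h1, sum_add_distrib, ← sum_mul, ← star_sum, hBc, star_zero, zero_mul, zero_add,
      mul_sum]

lemma integral_radial_norm_pow {R b : ℝ} (hR : 0 < R) (hb : b < R ^ 2 / 2) {F F' : ℝ → ℝ}
    (hF : ∀ t, HasDerivAt F (F' t) t) (hF' : Continuous F') (hF0 : ∀ t, b ≤ t → F t = 0)
    (hF'0 : ∀ t, b ≤ t → F' t = 0) (n : ℕ) (c : QH) :
    ∫ y : R3, F' (‖y‖ ^ 2 / 2) • (‖y‖ ^ (2 * (n + 1)) • c) =
      - ∫ y : R3, F (‖y‖ ^ 2 / 2) • (‖y‖ ^ (2 * n) • (2 * n + 3 : ℝ) • c) := by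
  have hg : ContDiff ℝ 1 fun y : R3 => ‖y‖ ^ (2 * n) • c := by
    simp_rw [pow_mul]
    exact ((contDiff_norm_sq ℝ).pow n).smul contDiff_const
  have hd : ∀ t : ℝ, HasDerivAt (fun t : ℝ => (2 * t) ^ n) (n * (2 * t) ^ (n - 1) * 2) t :=
    fun t => by simpa using ((hasDerivAt_id t).const_mul 2).fun_pow n
  have hpd : ∀ (i : Fin 3) (y : R3), pd i (fun y : R3 => ‖y‖ ^ (2 * n) • c) y =
      (n * ‖y‖ ^ (2 * (n - 1)) * 2 * y i) • c := fun i y => by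
    have h := pd_radial_smul (y := y) (hd _) (differentiableAt_const c) i
    have h2 : ∀ y : R3, 2 * (‖y‖ ^ 2 / 2) = ‖y‖ ^ 2 := fun y => by ring
    simp only [h2, ← pow_mul] at h
    rw [h]
    simp [pd]
  have h := integral_radial_div hR hb hF hF' hF0 hF'0
    (u := fun i y => y i • (‖y‖ ^ (2 * n) • c)) (fun i => ContDiff.contDiffOn
      (ContDiff.smul (EuclideanSpace.proj i : R3 →L[ℝ] ℝ).contDiff hg))
  have hsq : ∀ y : R3, y 0 * y 0 + y 1 * y 1 + y 2 * y 2 = ‖y‖ ^ 2 := fun y => by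
    rw [EuclideanSpace.norm_sq_eq]
    simp [Fin.sum_univ_three, sq]
  convert h using 3 with y
  · congr 1
    simp only [Fin.sum_univ_three, smul_smul, ← add_smul]
    congr 1
    rw [mul_add 2, pow_add, mul_one]
    linear_combination (-‖y‖ ^ (2 * n)) * hsq y
  · funext y
    congr 1
    have hcoord : ∀ i : Fin 3, pd i (fun y => y i • (‖y‖ ^ (2 * n) • c)) y =
        (‖y‖ ^ (2 * n) + y i * (n * ‖y‖ ^ (2 * (n - 1)) * 2 * y i)) • c := fun i => by
      rw [pd_coord_smul (hg.differentiable one_ne_zero y), hpd, if_pos rfl, smul_smul, ← add_smul]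
    rw [Fin.sum_univ_three, hcoord, hcoord, hcoord, ← add_smul, ← add_smul, smul_smul]
    congr 1
    rcases n with _ | n
    · simp; norm_num
    · rw [Nat.add_sub_cancel, mul_add 2, pow_add]
      push_cast
      linear_combination (-(n + 1) * 2 * ‖y‖ ^ (2 * n)) * hsq y

lemma pd_sum_coord_smul {h : R3 → QH} {x : R3} (hh : DifferentiableAt ℝ h x) (c : Fin 3 → QH)
    (i : Fin 3) : pd i (fun y => ∑ j, y j • (c j * h y)) x =
      c i * h x + ∑ j, x j • (c j * pd i h x) := by
  have hd : ∀ j : Fin 3, DifferentiableAt ℝ (fun y : R3 => y j • (c j * h y)) x := fun j =>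
    (EuclideanSpace.proj j : R3 →L[ℝ] ℝ).differentiableAt.smul (hh.const_mul (c j))
  simp only [Fin.sum_univ_three]
  rw [pd_add (f := fun y => y 0 • (c 0 * h y) + y 1 • (c 1 * h y)) ((hd 0).add (hd 1)) (hd 2),
    pd_add (hd 0) (hd 1), pd_coord_smul (hh.const_mul (c 0)), pd_coord_smul (hh.const_mul (c 1)),
    pd_coord_smul (hh.const_mul (c 2)), pd_const_mul hh, pd_const_mul hh, pd_const_mul hh]
  fin_cases i <;> simp <;> abel

/-- The integral of a monogenic function's Euler derivative against a radial cutoff vanishes. -/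
lemma integral_radial_euler_of_CRbar {R b : ℝ} (hR : 0 < R) (hb : b < R ^ 2 / 2) {G : ℝ → ℝ}
    (hG : ContDiff ℝ 1 G) (hG0 : ∀ t, b ≤ t → G t = 0) {h : R3 → QH}
    (hh : ContDiffOn ℝ 1 h (ball 0 R)) (hm : ∀ x ∈ ball (0 : R3) R, CRbar h x = 0) :
    ∫ y, G (‖y‖ ^ 2 / 2) • euler h y = 0 := by
  obtain ⟨b', hbb', hb'⟩ := exists_between hb
  have hG'0 : ∀ t, b' ≤ t → deriv G t = 0 := fun t ht => by
    rw [Filter.EventuallyEq.deriv_eq (f := fun _ => (0 : ℝ)), deriv_const]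
    filter_upwards [lt_mem_nhds (hbb'.trans_le ht)] with s hs using hG0 s hs.le
  let c : Fin 3 → Fin 3 → QH := ![![0, e1, e2], ![-e1, 0, -e3], ![-e2, e3, 0]]
  have hdiv := integral_radial_div hR hb'
    (fun t => (hG.differentiable one_ne_zero t).hasDerivAt) (hG.continuous_deriv le_rfl)
    (fun t ht => hG0 t (hbb'.le.trans ht)) hG'0 (u := fun i y => ∑ j, y j • (c i j * h y))
    (fun i => ContDiffOn.sum fun j _ => (EuclideanSpace.proj j : R3 →L[ℝ] ℝ).contDiff.contDiffOn.smul
      (contDiffOn_const.mul hh))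
  have h0 : ∀ y : R3, ∑ i, y i • ∑ j, y j • (c i j * h y) = 0 := fun y => by
    simp only [Fin.sum_univ_three, c, Matrix.cons_val, zero_mul, neg_mul]
    module
  simp only [h0, smul_zero, integral_zero] at hdiv
  rw [← neg_eq_zero, hdiv]
  congr 1
  refine integral_radial_congr hR hb hG0 fun y hy => ?_
  have hd : DifferentiableAt ℝ h y :=
    (hh.differentiableOn one_ne_zero).differentiableAt (isOpen_ball.mem_nhds hy)
  have hy0 : pd 0 h y = -(e1 * pd 1 h y) - e2 * pd 2 h y := by
    rw [← sub_eq_zero, ← hm y hy, CRbar]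
    abel
  rw [sum_congr rfl fun i _ => pd_sum_coord_smul hd (c i) i]
  simp only [euler, Fin.sum_univ_three, c, Matrix.cons_val, hy0]
  ext <;> simp <;> ring

end RadialDivergence

section SphericalMeans

/-- Integration in polar coordinates. -/
lemma integral_polar {φ : R3 → QH} (hφ : Integrable φ) :
    ∫ y, φ y = ∫ r in Set.Ioi (0 : ℝ), r ^ 2 •
      ∫ ω : sphere (0 : R3) 1, φ (r • (ω : R3)) ∂((volume : Measure R3).toSphere) := by
  have hmp := (volume : Measure R3).measurePreserving_homeomorphUnitSphereProd
  have hme := (homeomorphUnitSphereProd R3).measurableEmbedding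
  have hcomp : ∀ x : ({0}ᶜ : Set R3),
      φ ((homeomorphUnitSphereProd R3 x).2.1 • ((homeomorphUnitSphereProd R3 x).1 : R3)) = φ x := by
    intro x
    have hx : ‖(x : R3)‖ ≠ 0 := norm_ne_zero_iff.2 x.2
    simp [smul_smul, hx]
  have hint : Integrable (fun p : sphere (0 : R3) 1 × Set.Ioi (0 : ℝ) => φ (p.2.1 • (p.1 : R3)))
      ((volume : Measure R3).toSphere.prod (.volumeIoiPow (Module.finrank ℝ R3 - 1))) := by
    rw [← hmp.integrable_comp_emb hme]
    refine Integrable.congr (f := fun x : ({0}ᶜ : Set R3) => φ x) ?_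
      (Filter.Eventually.of_forall fun x => (hcomp x).symm)
    exact (MeasurableEmbedding.subtype_coe (measurableSet_singleton _).compl).integrable_map_iff.1
      (by
        rw [map_comap_subtype_coe (measurableSet_singleton _).compl]
        exact hφ.restrict)
  calc ∫ y, φ y = ∫ x : ({0}ᶜ : Set R3), φ x ∂(volume.comap Subtype.val) := by
        rw [integral_subtype_comap (measurableSet_singleton _).compl fun x => φ x,
          restrict_compl_singleton]
    _ = ∫ p, φ (p.2.1 • (p.1 : R3)) ∂((volume : Measure R3).toSphere.prod
          (.volumeIoiPow (Module.finrank ℝ R3 - 1))) := by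
        rw [← hmp.integral_comp hme]
        simp_rw [hcomp]
    _ = _ := by
        rw [integral_prod_symm _ hint]
        simp only [Measure.volumeIoiPow, ENNReal.ofReal]
        rw [integral_withDensity_eq_integral_smul
            (measurable_subtype_coe.pow_const _).real_toNNReal,
          integral_subtype_comap measurableSet_Ioi fun r =>
            Real.toNNReal (r ^ (Module.finrank ℝ R3 - 1)) •
              ∫ ω : sphere (0 : R3) 1, φ (r • (ω : R3)) ∂((volume : Measure R3).toSphere)]
        refine setIntegral_congr_fun measurableSet_Ioi fun r hr => ?_
        rw [NNReal.smul_def, Real.coe_toNNReal _ (pow_nonneg (le_of_lt hr) _)]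
        simp

lemma smul_sphere_mem_ball {R r : ℝ} (hr : |r| < R) (ω : sphere (0 : R3) 1) :
    r • (ω : R3) ∈ ball (0 : R3) R := by
  rw [mem_ball_zero_iff, norm_smul, norm_eq_of_mem_sphere ω, mul_one]
  exact hr

/-- The integral over the sphere of radius `r`, rescaled to the unit sphere. -/
def sphereMean (u : R3 → QH) (r : ℝ) : QH :=
  ∫ ω : sphere (0 : R3) 1, u (r • (ω : R3)) ∂((volume : Measure R3).toSphere)

lemma continuous_comp_smul_sphere {R r : ℝ} (hr : |r| < R) {E : Type*} [TopologicalSpace E]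
    {u : R3 → E} (hu : ContinuousOn u (ball 0 R)) :
    Continuous fun ω : sphere (0 : R3) 1 => u (r • (ω : R3)) :=
  hu.comp_continuous (by fun_prop) (smul_sphere_mem_ball hr)

lemma integrable_comp_smul_sphere {R r : ℝ} (hr : |r| < R)
    {u : R3 → QH} (hu : ContinuousOn u (ball 0 R)) :
    Integrable (fun ω : sphere (0 : R3) 1 => u (r • (ω : R3))) (volume : Measure R3).toSphere :=
  (continuous_comp_smul_sphere hr hu).integrable_of_hasCompactSupport
    (HasCompactSupport.of_compactSpace _)

/-- A function continuous on the ball is uniformly bounded on spheres of radius near `r`. -/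
lemma exists_bound_comp_smul_sphere {R r : ℝ} (hr : |r| < R) {E : Type*} [NormedAddCommGroup E]
    {u : R3 → E} (hu : ContinuousOn u (ball 0 R)) :
    ∃ δ > 0, ∃ C, ∀ s ∈ ball r δ, |s| < R ∧ ∀ ω : sphere (0 : R3) 1, ‖u (s • (ω : R3))‖ ≤ C := by
  obtain ⟨R', hrR', hR'⟩ := exists_between hr
  obtain ⟨C, hC⟩ := (isCompact_closedBall (0 : R3) R').exists_bound_of_continuousOn
    (hu.mono (closedBall_subset_ball hR'))
  refine ⟨R' - |r|, sub_pos.2 hrR', C, fun s hs => ?_⟩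
  have hs' : |s| < R' := by
    have h1 := mem_ball.1 hs
    rw [Real.dist_eq] at h1
    have h2 := abs_add_le (s - r) r
    rw [sub_add_cancel] at h2
    linarith
  exact ⟨hs'.trans hR', fun ω => hC _ (ball_subset_closedBall (smul_sphere_mem_ball hs' ω))⟩

lemma continuousAt_sphereMean {R r : ℝ} (hr : |r| < R) {u : R3 → QH}
    (hu : ContinuousOn u (ball 0 R)) : ContinuousAt (sphereMean u) r := by
  obtain ⟨δ, hδ, C, hC⟩ := exists_bound_comp_smul_sphere hr hu
  refine continuousAt_of_dominated (bound := fun _ => C) ?_ ?_ (integrable_const C) ?_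
  · filter_upwards [ball_mem_nhds r hδ] with s hs
    exact (integrable_comp_smul_sphere (hC s hs).1 hu).aestronglyMeasurable
  · filter_upwards [ball_mem_nhds r hδ] with s hs
    exact Filter.Eventually.of_forall (hC s hs).2
  · refine Filter.Eventually.of_forall fun ω => ?_
    have h1 := hu.continuousAt (isOpen_ball.mem_nhds (smul_sphere_mem_ball hr ω))
    exact ContinuousAt.comp (f := fun s : ℝ => s • (ω : R3)) h1 (by fun_prop)

lemma half_norm_smul_sphere (r : ℝ) (ω : sphere (0 : R3) 1) :
    ‖r • (ω : R3)‖ ^ 2 / 2 = r ^ 2 / 2 := by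
  rw [norm_smul, norm_eq_of_mem_sphere ω, mul_one, Real.norm_eq_abs, sq_abs]

lemma integral_radial_eq_sphereMean {R b : ℝ} (hR : 0 < R) (hb : b < R ^ 2 / 2) {G : ℝ → ℝ}
    (hG : Continuous G) (hG0 : ∀ t, b ≤ t → G t = 0) {u : R3 → QH}
    (hu : ContinuousOn u (ball 0 R)) :
    ∫ y, G (‖y‖ ^ 2 / 2) • u y =
      ∫ r in Set.Ioi (0 : ℝ), (r ^ 2 * G (r ^ 2 / 2)) • sphereMean u r := by
  rw [integral_polar (integrable_radial_smul hR hb hG hG0 hu)]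
  simp_rw [half_norm_smul_sphere, integral_smul, smul_smul]
  rfl

/-- If all integrals of `u` against smooth radial cutoffs vanish, so do its spherical means. -/
lemma sphereMean_eq_zero {R : ℝ} (hR : 0 < R) {u : R3 → QH} (hu : ContinuousOn u (ball 0 R))
    (h : ∀ (G : ℝ → ℝ) (b : ℝ), ContDiff ℝ 1 G → b < R ^ 2 / 2 → (∀ t, b ≤ t → G t = 0) →
      ∫ y, G (‖y‖ ^ 2 / 2) • u y = 0) {r : ℝ} (hr : r ∈ Set.Ioo 0 R) : sphereMean u r = 0 := by
  have habs : ∀ s ∈ Set.Ioo 0 R, |s| < R := fun s hs => by rw [abs_of_pos hs.1]; exact hs.2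
  have hcont : ContinuousOn (fun s => s ^ 2 • sphereMean u s) (Set.Ioo 0 R) := fun s hs =>
    ((continuousAt_id.pow 2).smul (continuousAt_sphereMean (habs s hs) hu)).continuousWithinAt
  have hae := isOpen_Ioo.ae_eq_zero_of_integral_contDiff_smul_eq_zero (μ := volume)
    (f := fun s => s ^ 2 • sphereMean u s) (U := Set.Ioo 0 R)
    (hcont.locallyIntegrableOn measurableSet_Ioo) (fun g hg hgc hgs => by
      have hgz : ∀ s ∉ tsupport g, g s = 0 := fun s hs => image_eq_zero_of_notMem_tsupport hs
      obtain ⟨R', hR'0, hR'R, hgR'⟩ : ∃ R', 0 < R' ∧ R' < R ∧ ∀ s, R' ≤ s → g s = 0 := by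
        rcases (tsupport g).eq_empty_or_nonempty with he | hne
        · exact ⟨R / 2, by linarith, by linarith, fun s _ => hgz s (by simp [he])⟩
        · obtain ⟨m, hm, hmax⟩ := hgc.isCompact.exists_isMaxOn hne continuousOn_id
          obtain ⟨R', h1, h2⟩ := exists_between (hgs hm).2
          refine ⟨R', (hgs hm).1.trans h1, h2, fun s hs => hgz s fun hs' => ?_⟩
          exact absurd (hmax hs') (not_le.2 (h1.trans_le hs))
      let G : ℝ → ℝ := fun t => g (√(2 * t))
      have hG : ContDiff ℝ 1 G := by
        rw [contDiff_iff_contDiffAt]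
        intro t
        by_cases ht : 2 * t = 0
        · have h0 : (0 : ℝ) ∉ tsupport g := fun h0 => lt_irrefl _ (hgs h0).1
          have hev : ∀ᶠ s in nhds (√(2 * t)), s ∉ tsupport g := by
            rw [ht, Real.sqrt_zero]
            exact (isClosed_tsupport g).isOpen_compl.mem_nhds h0
          have hsq : ContinuousAt (fun t : ℝ => √(2 * t)) t := by fun_prop
          refine (contDiffAt_const (c := (0 : ℝ))).congr_of_eventuallyEq ?_
          filter_upwards [hsq.eventually hev] with s hs using hgz _ hs
        · exact ((hg.of_le (by norm_cast)).contDiffAt).comp t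
            ((contDiffAt_const.mul contDiffAt_id).sqrt ht)
      have hG0 : ∀ t, R' ^ 2 / 2 ≤ t → G t = 0 := fun t ht =>
        hgR' _ (Real.le_sqrt_of_sq_le (by linarith))
      have hlt : R' ^ 2 / 2 < R ^ 2 / 2 := by nlinarith
      have := h G _ hG hlt hG0
      rw [integral_radial_eq_sphereMean hR hlt hG.continuous hG0 hu] at this
      rw [← this, ← setIntegral_eq_integral_of_forall_compl_eq_zero (s := Set.Ioi (0 : ℝ))]
      · refine setIntegral_congr_fun measurableSet_Ioi fun s hs => ?_
        simp only [G]
        rw [show 2 * (s ^ 2 / 2) = s ^ 2 by ring, Real.sqrt_sq (le_of_lt hs), smul_smul, mul_comm]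
      · intro s hs
        rw [hgz s fun hs' => hs (hgs hs').1, zero_smul])
  have hzero : Set.EqOn (fun s => s ^ 2 • sphereMean u s) (fun _ => 0) (Set.Ioo 0 R) :=
    Measure.eqOn_open_of_ae_eq (μ := volume)
      ((ae_restrict_iff' measurableSet_Ioo).2 hae) isOpen_Ioo hcont continuousOn_const
  exact (smul_eq_zero.1 (hzero hr)).resolve_left (pow_ne_zero 2 hr.1.ne')

/-- Equality of spherical means implies equality of radially weighted integrals. -/
lemma integral_radial_eq_of_sphereMean_eq {R b : ℝ} (hR : 0 < R) (hb : b < R ^ 2 / 2) {G : ℝ → ℝ}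
    (hG : Continuous G) (hG0 : ∀ t, b ≤ t → G t = 0) {u v : R3 → QH}
    (hu : ContinuousOn u (ball 0 R)) (hv : ContinuousOn v (ball 0 R))
    (h : ∀ r ∈ Set.Ioo 0 R, sphereMean u r = sphereMean v r) :
    ∫ y, G (‖y‖ ^ 2 / 2) • u y = ∫ y, G (‖y‖ ^ 2 / 2) • v y := by
  rw [integral_radial_eq_sphereMean hR hb hG hG0 hu, integral_radial_eq_sphereMean hR hb hG hG0 hv]
  refine setIntegral_congr_fun measurableSet_Ioi fun r hr => ?_
  by_cases hrR : r < R
  · rw [h r ⟨hr, hrR⟩]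
  · rw [hG0 _ (by nlinarith), mul_zero, zero_smul, zero_smul]

end SphericalMeans

section MeanValue

lemma sphereMean_const (c : QH) (r : ℝ) : sphereMean (fun _ => c) r = (4 * Real.pi) • c := by
  have h : (volume : Measure R3).toSphere.real Set.univ = 4 * Real.pi := by
    rw [Measure.toSphere_real_apply_univ, Measure.real, EuclideanSpace.volume_ball_fin_three]
    simp
    rw [ENNReal.toReal_ofReal (by positivity)]
    ring
  rw [sphereMean, integral_const, h]

lemma hasDerivAt_sphereMean {R r : ℝ} (hr : |r| < R) {u : R3 → QH}
    (hu : ContDiffOn ℝ 1 u (ball 0 R)) :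
    HasDerivAt (sphereMean u) (∫ ω : sphere (0 : R3) 1, fderiv ℝ u (r • (ω : R3)) ω
      ∂((volume : Measure R3).toSphere)) r := by
  have hu' : ContinuousOn (fderiv ℝ u) (ball 0 R) :=
    hu.continuousOn_fderiv_of_isOpen isOpen_ball le_rfl
  obtain ⟨δ, hδ, C, hC⟩ := exists_bound_comp_smul_sphere (E := R3 →L[ℝ] QH) (u := fderiv ℝ u) hr hu'
  refine (hasDerivAt_integral_of_dominated_loc_of_deriv_le (bound := fun _ => C)
    (F := fun s (ω : sphere (0 : R3) 1) => u (s • (ω : R3)))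
    (F' := fun s (ω : sphere (0 : R3) 1) => fderiv ℝ u (s • (ω : R3)) ω)
    (ball_mem_nhds r hδ) ?_ (integrable_comp_smul_sphere hr hu.continuousOn) ?_ ?_
    (integrable_const C) ?_).2
  · filter_upwards [ball_mem_nhds r hδ] with s hs
    exact (integrable_comp_smul_sphere (hC s hs).1 hu.continuousOn).aestronglyMeasurable
  · exact ((continuous_comp_smul_sphere hr hu').clm_apply
      continuous_subtype_val).aestronglyMeasurable
  · refine Filter.Eventually.of_forall fun ω s hs => ?_
    refine (ContinuousLinearMap.le_opNorm _ _).trans ?_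
    rw [norm_eq_of_mem_sphere ω, mul_one]
    exact (hC s hs).2 ω
  · refine Filter.Eventually.of_forall fun ω s hs => ?_
    have h1 : HasFDerivAt u (fderiv ℝ u (s • (ω : R3))) (s • (ω : R3)) :=
      ((hu.differentiableOn one_ne_zero).differentiableAt (isOpen_ball.mem_nhds
        (smul_sphere_mem_ball (hC s hs).1 ω))).hasFDerivAt
    have h2 : HasDerivAt (fun s : ℝ => s • (ω : R3)) (ω : R3) s := by
      simpa using (hasDerivAt_id s).smul_const (ω : R3)
    exact h1.comp_hasDerivAt s h2

lemma smul_integral_fderiv_sphere (u : R3 → QH) (r : ℝ) :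
    r • (∫ ω : sphere (0 : R3) 1, fderiv ℝ u (r • (ω : R3)) ω
      ∂((volume : Measure R3).toSphere)) = sphereMean (euler u) r := by
  rw [← integral_smul, sphereMean]
  congr 1
  funext ω
  rw [← map_smul, fderiv_self_eq_sum]
  rfl

/-- If the spherical means of the Euler derivative vanish, the mean value property holds. -/
lemma sphereMean_eq_of_euler {R : ℝ} {u : R3 → QH} (hu : ContDiffOn ℝ 1 u (ball 0 R))
    (h : ∀ r ∈ Set.Ioo 0 R, sphereMean (euler u) r = 0) {r : ℝ} (hr : r ∈ Set.Ioo 0 R) :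
    sphereMean u r = (4 * Real.pi) • u 0 := by
  have hR : 0 < R := hr.1.trans hr.2
  have hder : ∀ s ∈ Set.Ioo 0 R, HasDerivAt (sphereMean u) 0 s := fun s hs => by
    have h1 := hasDerivAt_sphereMean (by rw [abs_of_pos hs.1]; exact hs.2) hu
    have h2 := smul_integral_fderiv_sphere u s
    rw [h s hs, smul_eq_zero] at h2
    rwa [h2.resolve_left hs.1.ne'] at h1
  have hconst : ∀ s ∈ Set.Ioo 0 r, sphereMean u r = sphereMean u s := fun s hs =>
    constant_of_has_deriv_right_zero
      (fun t ht => (hder t ⟨hs.1.trans_le ht.1, ht.2.trans_lt hr.2⟩).continuousAt.continuousWithinAt)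
      (fun t ht => (hder t ⟨hs.1.trans_le ht.1, ht.2.trans hr.2⟩).hasDerivWithinAt)
      r (Set.right_mem_Icc.2 hs.2.le)
  have h0 : sphereMean u 0 = (4 * Real.pi) • u 0 := by
    rw [← sphereMean_const (u 0) 0]
    simp [sphereMean]
  have hlim : Filter.Tendsto (sphereMean u) (nhdsWithin 0 (Set.Ioi 0)) (nhds (sphereMean u 0)) :=
    (continuousAt_sphereMean (by simpa using hR) hu.continuousOn).continuousWithinAt
  rw [← h0]
  refine tendsto_nhds_unique (tendsto_const_nhds.congr' ?_) hlim
  filter_upwards [Ioo_mem_nhdsGT hr.1] with s hs using hconst s hs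

lemma continuousOn_euler {R : ℝ} {u : R3 → QH} (hu : ContDiffOn ℝ 1 u (ball 0 R)) :
    ContinuousOn (euler u) (ball 0 R) :=
  continuousOn_finsetSum _ fun i _ =>
    (by fun_prop : Continuous fun y : R3 => y i).continuousOn.smul (continuousOn_pd isOpen_ball hu i)

/-- The mean value property of monogenic functions. -/
lemma sphereMean_of_CRbar {R : ℝ} {u : R3 → QH} (hu : ContDiffOn ℝ 1 u (ball 0 R))
    (hm : ∀ x ∈ ball (0 : R3) R, CRbar u x = 0) {r : ℝ} (hr : r ∈ Set.Ioo 0 R) :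
    sphereMean u r = (4 * Real.pi) • u 0 := by
  have hR : 0 < R := hr.1.trans hr.2
  exact sphereMean_eq_of_euler hu (fun s hs => sphereMean_eq_zero hR (continuousOn_euler hu)
    (fun G b hG hb hG0 => integral_radial_euler_of_CRbar hR hb hG hG0 hu hm) hs) hr

/-- The mean value property of harmonic functions. -/
lemma sphereMean_of_harmonic {R : ℝ} {u : R3 → QH} (hu : ContDiffOn ℝ 2 u (ball 0 R))
    (hm : ∀ x ∈ ball (0 : R3) R, ∑ i, pd i (pd i u) x = 0) {r : ℝ} (hr : r ∈ Set.Ioo 0 R) :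
    sphereMean u r = (4 * Real.pi) • u 0 := by
  have hR : 0 < R := hr.1.trans hr.2
  have hu1 : ContDiffOn ℝ 1 u (ball 0 R) := hu.of_le (by norm_num)
  refine sphereMean_eq_of_euler hu1 (fun s hs => sphereMean_eq_zero hR (continuousOn_euler hu1)
    (fun G b hG hb hG0 => ?_) hs) hr
  obtain ⟨K, hK, hK0⟩ := exists_primitive_vanishing hG.continuous hG0
  have h := integral_radial_div hR hb hK hG.continuous hK0 hG0 (u := fun i => pd i u)
    (fun i => contDiffOn_pd isOpen_ball hu (by norm_num) i)
  refine h.trans ?_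
  rw [integral_radial_congr hR hb hK0 hm]
  simp

end MeanValue

section Regularity

lemma pd_comp_const_add (f : R3 → QH) (a x : R3) (i : Fin 3) :
    pd i (fun y => f (a + y)) x = pd i f (a + x) := by
  rw [pd, fderiv_comp_add_left]
  rfl

/-- Continuously differentiable monogenic functions are smooth. -/
lemma contDiffOn_of_CRbar {R : ℝ} {f : R3 → QH} (hf : ContDiffOn ℝ 1 f (ball 0 R))
    (hm : ∀ x ∈ ball (0 : R3) R, CRbar f x = 0) : ContDiffOn ℝ (⊤ : ℕ∞) f (ball 0 R) := by
  intro x₀ hx₀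
  refine ContDiffAt.contDiffWithinAt ?_
  obtain ⟨ε, hε, hεR⟩ := Metric.isOpen_iff.1 isOpen_ball x₀ hx₀
  set δ := ε / 3 with hδ
  have hδ0 : 0 < δ := by positivity
  have hsub : closedBall x₀ (2 * δ) ⊆ ball 0 R :=
    (closedBall_subset_ball (by linarith)).trans hεR
  let G : ℝ → ℝ := fun t => Real.smoothTransition (δ ^ 2 / 4 - t)
  have hG : ContDiff ℝ (⊤ : ℕ∞) G := Real.smoothTransition.contDiff.comp (contDiff_const.sub contDiff_id)
  have hG0 : ∀ t, δ ^ 2 / 4 ≤ t → G t = 0 := fun t ht =>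
    Real.smoothTransition.zero_of_nonpos (by linarith)
  have hb : δ ^ 2 / 4 < δ ^ 2 / 2 := by nlinarith [sq_pos_of_pos hδ0]
  let φ : R3 → ℝ := fun y => G (‖y‖ ^ 2 / 2)
  have hφ : ContDiff ℝ (⊤ : ℕ∞) φ := hG.comp contDiff_half_norm_sq
  have hφc : HasCompactSupport φ := by
    simpa using hasCompactSupport_radial_smul hG0 (fun _ => (1 : ℝ))
  have hφ0 : ∀ y, δ ≤ ‖y‖ → φ y = 0 := fun y hy => hG0 _ (by nlinarith)
  have hI : 0 < ∫ y, φ y := by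
    refine hφ.continuous.integral_pos_of_hasCompactSupport_nonneg_nonzero hφc
      (fun y => Real.smoothTransition.nonneg _) (x := 0) ?_
    simp only [φ, G, norm_zero]
    exact (Real.smoothTransition.pos_of_pos (by nlinarith [sq_pos_of_pos hδ0])).ne'
  let f' : R3 → QH := (closedBall x₀ (2 * δ)).indicator f
  have hf' : Integrable f' := (integrable_indicator_iff measurableSet_closedBall).2
    ((hf.continuousOn.mono hsub).integrableOn_compact (isCompact_closedBall _ _))
  have hconv := hφc.contDiff_convolution_left (ContinuousLinearMap.lsmul ℝ ℝ) hφ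
    hf'.locallyIntegrable
  refine (hconv.contDiffAt.const_smul (∫ y, φ y)⁻¹).congr_of_eventuallyEq ?_
  filter_upwards [ball_mem_nhds x₀ hδ0] with x hx
  have hshift : ∀ y ∈ ball (0 : R3) δ, x + y ∈ closedBall x₀ (2 * δ) := fun y hy => by
    rw [mem_closedBall, dist_eq_norm]
    rw [mem_ball, dist_eq_norm] at hx hy
    rw [sub_zero] at hy
    calc ‖x + y - x₀‖ = ‖(x - x₀) + y‖ := by congr 1; abel
      _ ≤ ‖x - x₀‖ + ‖y‖ := norm_add_le _ _
      _ ≤ 2 * δ := by linarith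
  have hfx : ContDiffOn ℝ 1 (fun y => f (x + y)) (ball 0 δ) :=
    hf.comp (contDiff_const.add contDiff_id).contDiffOn fun y hy => hsub (hshift y hy)
  have hmx : ∀ y ∈ ball (0 : R3) δ, CRbar (fun y => f (x + y)) y = 0 := fun y hy => by
    rw [← hm _ (hsub (hshift y hy))]
    simp only [CRbar, pd_comp_const_add]
  have hmean := integral_radial_eq_of_sphereMean_eq hδ0 hb hG.continuous hG0 hfx.continuousOn
    (continuousOn_const (c := f x)) (fun r hr => by
      rw [sphereMean_of_CRbar hfx hmx hr, sphereMean_const, add_zero])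
  rw [integral_smul_const] at hmean
  rw [eq_inv_smul_iff₀ hI.ne', ← hmean, convolution_def, ← integral_neg_eq_self]
  congr 1
  funext y
  simp only [ContinuousLinearMap.lsmul_apply, φ, norm_neg, sub_eq_add_neg]
  by_cases hy : y ∈ ball (0 : R3) δ
  · have hmem := hshift (-y) (by simpa using hy)
    rw [show f' (x + -y) = f (x + -y) from Set.indicator_of_mem hmem f]
  · have : G (‖y‖ ^ 2 / 2) = 0 := hφ0 y (by simpa using hy)
    rw [this, zero_smul, zero_smul]

end Regularity

section RadialMeans

/-- Against every radial weight supported inside the ball of radius `R`, the function `u` has the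
same integral as `‖y‖ ^ (2 * n) • c`. -/
def HasRadialMean (R : ℝ) (u : R3 → QH) (n : ℕ) (c : QH) : Prop :=
  ∀ (G : ℝ → ℝ) (b : ℝ), Continuous G → b < R ^ 2 / 2 → (∀ t, b ≤ t → G t = 0) →
    ∫ y, G (‖y‖ ^ 2 / 2) • u y = ∫ y : R3, G (‖y‖ ^ 2 / 2) • (‖y‖ ^ (2 * n) • c)

lemma HasRadialMean.succ {R : ℝ} (hR : 0 < R) {u v : R3 → QH} {n : ℕ} {c : QH} (k : ℝ)
    (hv : HasRadialMean R v n c)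
    (h : ∀ (F F' : ℝ → ℝ) (b : ℝ), b < R ^ 2 / 2 → (∀ t, HasDerivAt F (F' t) t) → Continuous F' →
      (∀ t, b ≤ t → F t = 0) → (∀ t, b ≤ t → F' t = 0) →
      ∫ y, F' (‖y‖ ^ 2 / 2) • u y = - (k • ∫ y, F (‖y‖ ^ 2 / 2) • v y)) :
    HasRadialMean R u (n + 1) ((k / (2 * n + 3)) • c) := by
  intro G b hG hb hG0
  obtain ⟨K, hK, hK0⟩ := exists_primitive_vanishing hG hG0
  have hKc : Continuous K := continuous_iff_continuousAt.2 fun t => (hK t).continuousAt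
  rw [h K G b hb hK hG hK0 hG0, hv K b hKc hb hK0, integral_radial_norm_pow hR hb hK hG hK0 hG0,
    ← integral_smul]
  have hn : (2 * n + 3 : ℝ) ≠ 0 := by positivity
  congr 2
  funext y
  match_scalars
  field_simp

end RadialMeans

section FirstOrder

lemma star_real_smul (a : ℝ) (q : QH) : star (a • q) = a • star q := starLin.map_smul a q

lemma components_one : (1 : QH).re = 1 ∧ (1 : QH).imI = 0 ∧ (1 : QH).imJ = 0 ∧ (1 : QH).imK = 0 :=
  ⟨rfl, rfl, rfl, rfl⟩

/-- The first order differential operator with quaternionic coefficients `c`. -/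
def firstOrder (c : Fin 3 → QH) (f : R3 → QH) (x : R3) : QH := ∑ i, c i * pd i f x

lemma CRbar_eq_firstOrder (f : R3 → QH) : CRbar f = firstOrder ![1, e1, e2] f := by
  funext x
  simp [CRbar, firstOrder, Fin.sum_univ_three]

lemma D0_eq_firstOrder (f : R3 → QH) :
    D0 f = fun x => (1 / 2 : ℝ) • firstOrder ![1, -e1, -e2] f x := by
  funext x
  simp [D0, firstOrder, Fin.sum_univ_three, sub_eq_add_neg]

lemma DbarC_eq_firstOrder (f : R3 → QH) :
    DbarC f = fun x => (1 / 2 : ℝ) • firstOrder ![0, 1, e3] f x := by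
  funext x
  simp [DbarC, firstOrder, Fin.sum_univ_three]

variable {R : ℝ} {f : R3 → QH}

lemma contDiffOn_pd_infty (hf : ContDiffOn ℝ (⊤ : ℕ∞) f (ball 0 R)) (i : Fin 3) :
    ContDiffOn ℝ (⊤ : ℕ∞) (pd i f) (ball 0 R) :=
  contDiffOn_pd isOpen_ball hf (by simp) i

lemma contDiffOn_firstOrder (hf : ContDiffOn ℝ (⊤ : ℕ∞) f (ball 0 R)) (c : Fin 3 → QH) :
    ContDiffOn ℝ (⊤ : ℕ∞) (firstOrder c f) (ball 0 R) :=
  ContDiffOn.sum fun i _ => contDiffOn_const.mul (contDiffOn_pd_infty hf i)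

lemma contDiffOn_two_of_infty (hf : ContDiffOn ℝ (⊤ : ℕ∞) f (ball 0 R)) :
    ContDiffOn ℝ 2 f (ball 0 R) :=
  hf.of_le (WithTop.coe_le_coe.2 (le_top : (2 : ℕ∞) ≤ ⊤))

lemma differentiableAt_of_infty (hf : ContDiffOn ℝ (⊤ : ℕ∞) f (ball 0 R)) {x : R3}
    (hx : x ∈ ball (0 : R3) R) : DifferentiableAt ℝ f x :=
  (hf.differentiableOn (by simp)).differentiableAt (isOpen_ball.mem_nhds hx)

lemma pd_congr {s : Set R3} (hs : IsOpen s) {f g : R3 → QH} (h : ∀ x ∈ s, f x = g x) {x : R3}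
    (hx : x ∈ s) (i : Fin 3) : pd i f x = pd i g x := by
  have : f =ᶠ[nhds x] g := by
    filter_upwards [hs.mem_nhds hx] with y hy using h y hy
  rw [pd, pd, this.fderiv_eq]

lemma pd_sum {g : Fin 3 → R3 → QH} {x : R3} (hg : ∀ i, DifferentiableAt ℝ (g i) x) (j : Fin 3) :
    pd j (fun y => ∑ i, g i y) x = ∑ i, pd j (g i) x := by
  rw [pd, fderiv_fun_sum fun i _ => hg i]
  simp [pd]

lemma pd_firstOrder (hf : ContDiffOn ℝ (⊤ : ℕ∞) f (ball 0 R)) (c : Fin 3 → QH) {x : R3}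
    (hx : x ∈ ball (0 : R3) R) (j : Fin 3) :
    pd j (firstOrder c f) x = firstOrder c (pd j f) x := by
  have hd := fun i => differentiableAt_of_infty (contDiffOn_pd_infty hf i) hx
  refine (pd_sum (fun i => (hd i).const_mul (c i)) j).trans (sum_congr rfl fun i _ => ?_)
  rw [pd_const_mul (hd i), pd_comm isOpen_ball (contDiffOn_two_of_infty hf) hx]

lemma pd_half_smul_firstOrder (hf : ContDiffOn ℝ (⊤ : ℕ∞) f (ball 0 R)) (c : Fin 3 → QH) {x : R3}
    (hx : x ∈ ball (0 : R3) R) (j : Fin 3) :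
    pd j (fun y => (1 / 2 : ℝ) • firstOrder c f y) x =
      (1 / 2 : ℝ) • firstOrder c (pd j f) x := by
  rw [pd_const_smul (differentiableAt_of_infty (contDiffOn_firstOrder hf c) hx),
    pd_firstOrder hf c hx]

/-- Smooth functions satisfying Laplace's equation on the ball of radius `R`. -/
structure IsHarmonicOnBall (R : ℝ) (h : R3 → QH) : Prop where
  contDiffOn : ContDiffOn ℝ (⊤ : ℕ∞) h (ball 0 R)
  laplacian : ∀ x ∈ ball (0 : R3) R, ∑ i, pd i (pd i h) x = 0

/-- Smooth monogenic functions on the ball of radius `R`. -/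
structure IsMonogenicOnBall (R : ℝ) (f : R3 → QH) : Prop where
  contDiffOn : ContDiffOn ℝ (⊤ : ℕ∞) f (ball 0 R)
  CRbar_eq : ∀ x ∈ ball (0 : R3) R, CRbar f x = 0

lemma IsMonogenicOnBall.CRbar_pd (hf : IsMonogenicOnBall R f) {x : R3}
    (hx : x ∈ ball (0 : R3) R) (i : Fin 3) : CRbar (pd i f) x = 0 := by
  rw [CRbar_eq_firstOrder, ← pd_firstOrder hf.contDiffOn _ hx, ← CRbar_eq_firstOrder,
    pd_congr isOpen_ball (g := fun _ => 0) hf.CRbar_eq hx]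
  simp [pd]

lemma IsMonogenicOnBall.harmonic (hf : IsMonogenicOnBall R f) : IsHarmonicOnBall R f := by
  refine ⟨hf.contDiffOn, fun x hx => ?_⟩
  have hc := pd_comm isOpen_ball (contDiffOn_two_of_infty hf.contDiffOn) hx
  have h : ∑ i, pd i (pd i f) x =
      CRbar (pd 0 f) x - e1 * CRbar (pd 1 f) x - e2 * CRbar (pd 2 f) x := by
    simp only [Fin.sum_univ_three, CRbar, hc 1 0, hc 2 0, hc 2 1]
    ext <;> simp <;> ring
  rw [h, hf.CRbar_pd hx, hf.CRbar_pd hx, hf.CRbar_pd hx]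
  simp

lemma IsMonogenicOnBall.hypercomplexDeriv (hf : IsMonogenicOnBall R f) :
    IsMonogenicOnBall R (D0 f) := by
  rw [D0_eq_firstOrder]
  refine ⟨(contDiffOn_firstOrder hf.contDiffOn _).const_smul _, fun x hx => ?_⟩
  have hc := pd_comm isOpen_ball (contDiffOn_two_of_infty hf.contDiffOn) hx
  have h : CRbar (fun y => (1 / 2 : ℝ) • firstOrder ![1, -e1, -e2] f y) x =
      (1 / 2 : ℝ) • ∑ i, pd i (pd i f) x := by
    simp only [CRbar, pd_half_smul_firstOrder hf.contDiffOn _ hx]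
    simp only [firstOrder, Fin.sum_univ_three, hc 1 0, hc 2 0, hc 2 1]
    ext <;> simp <;> ring
  rw [h, hf.harmonic.laplacian x hx, smul_zero]

lemma IsHarmonicOnBall.planarDeriv {h : R3 → QH} (hh : IsHarmonicOnBall R h) :
    IsHarmonicOnBall R (DbarC h) := by
  have hs := contDiffOn_pd_infty hh.contDiffOn
  rw [DbarC_eq_firstOrder]
  refine ⟨(contDiffOn_firstOrder hh.contDiffOn _).const_smul _, fun x hx => ?_⟩
  have h1 : ∀ i, pd i (pd i fun y => (1 / 2 : ℝ) • firstOrder ![0, 1, e3] h y) x =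
      (1 / 2 : ℝ) • firstOrder ![0, 1, e3] (pd i (pd i h)) x := fun i => by
    rw [pd_congr isOpen_ball (fun y hy => pd_half_smul_firstOrder hh.contDiffOn _ hy i) hx,
      pd_half_smul_firstOrder (hs i) _ hx]
  have h2 : ∀ j, ∑ i, pd j (pd i (pd i h)) x = 0 := fun j => by
    rw [← pd_sum fun i => differentiableAt_of_infty (contDiffOn_pd_infty (hs i) i) hx,
      pd_congr isOpen_ball (g := fun _ => 0) hh.laplacian hx]
    simp [pd]
  simp only [h1, ← smul_sum]
  simp only [firstOrder]
  rw [sum_comm]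
  simp [← mul_sum, h2]

end FirstOrder

section RadialMeanAppell

lemma IsHarmonicOnBall.hasRadialMean {R : ℝ} (hR : 0 < R) {h : R3 → QH}
    (hh : IsHarmonicOnBall R h) : HasRadialMean R h 0 (h 0) := by
  intro G b hG hb hG0
  simp only [mul_zero, pow_zero, one_smul]
  refine integral_radial_eq_of_sphereMean_eq hR hb hG hG0 hh.contDiffOn.continuousOn
    continuousOn_const fun r hr => ?_
  rw [sphereMean_of_harmonic (contDiffOn_two_of_infty hh.contDiffOn) hh.laplacian hr,
    sphereMean_const]

lemma IsHarmonicOnBall.hasRadialMean_zeta {R : ℝ} (hR : 0 < R) (l : ℕ) {h : R3 → QH}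
    (hh : IsHarmonicOnBall R h) :
    HasRadialMean R (fun y => star (zeta y ^ l) * h y) l
      ((4 ^ l * l.factorial / (2 * l + 1).factorial : ℝ) • (DbarC^[l] h) 0) := by
  induction l generalizing h with
  | zero => simpa using hh.hasRadialMean hR
  | succ l ih =>
    have step := (ih hh.planarDeriv).succ hR (u := fun y => star (zeta y ^ (l + 1)) * h y) 2
      fun F F' b hb hF hF' hF0 hF'0 => by
        have h1 := integral_radial_star_mul hR hb hF hF' hF0 hF'0 ![0, 1, e3]
          (contDiff_zeta.pow l) (fun x => by
            simp only [Fin.sum_univ_three, pd_zeta_pow]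
            ext <;> simp <;> rfl)
          (hh.contDiffOn.of_le (by simp))
        have h2 : ∀ y : R3, ∑ i, y i • (![0, 1, e3] : Fin 3 → QH) i = star (zeta y) := fun y => by
          ext <;> simp [Fin.sum_univ_three, components_one]
        have h3 : ∀ y, ∑ i, (![0, 1, e3] : Fin 3 → QH) i * pd i h y = (2 : ℝ) • DbarC h y :=
          fun y => by
          rw [DbarC_eq_firstOrder, smul_smul]
          norm_num [firstOrder]
        simp only [h2, h3, ← mul_assoc, ← star_mul, ← pow_succ'] at h1
        rw [h1, ← integral_smul]
        simp only [mul_smul_comm, smul_comm (2 : ℝ)]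
    convert step using 1
    rw [smul_smul, Function.iterate_succ_apply]
    congr 1
    rw [show 2 * (l + 1) + 1 = (2 * l + 1) + 1 + 1 by ring, Nat.factorial_succ, Nat.factorial_succ,
      Nat.factorial_succ]
    push_cast
    field_simp
    ring

lemma IsMonogenicOnBall.hasRadialMean_appellPair {R : ℝ} (hR : 0 < R) (l m : ℕ) {f : R3 → QH}
    (hf : IsMonogenicOnBall R f) :
    HasRadialMean R (fun y => star ((appellPair l m).1 y) * f y) (l + m)
      ((4 ^ l * l.factorial / ((2 * l + 1).factorial * m.factorial) : ℝ) •
        (DbarC^[l] (D0^[m] f)) 0) := by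
  induction m generalizing f with
  | zero => simpa [appellPair] using hf.harmonic.hasRadialMean_zeta hR l
  | succ m ih =>
    have hP := isAppellPair_appellPair l m
    have step := (ih hf.hypercomplexDeriv).succ hR
      (u := fun y => star ((appellPair l (m + 1)).1 y) * f y) ((2 * l + 2 * m + 3) / (m + 1))
      fun F F' b hb hF hF' hF0 hF'0 => by
        have hf1 : ContDiffOn ℝ 1 f (ball 0 R) := hf.contDiffOn.of_le (by simp)
        have h1 := integral_radial_star_mul hR hb hF hF' hF0 hF'0 ![1, -e1, -e2]
          hP.contDiff_fst (fun x => by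
            rw [← hP.CRbar_fst x, CRbar]
            simp only [Fin.sum_univ_three]
            ext <;> simp) hf1
        have h2 := integral_radial_star_mul hR hb hF hF' hF0 hF'0 ![1, e1, e2]
          hP.contDiff_snd (fun x => by
            rw [← hP.Dadj_snd x, Dadj]
            simp only [Fin.sum_univ_three]
            ext <;> simp <;> ring) hf1
        have s1 : ∀ y : R3, ∑ i, y i • (![1, -e1, -e2] : Fin 3 → QH) i = star (toQ y) :=
          fun y => by ext <;> simp [Fin.sum_univ_three, components_one]
        have s2 : ∀ y : R3, ∑ i, y i • (![1, e1, e2] : Fin 3 → QH) i = star (toQbar y) :=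
          fun y => by ext <;> simp [Fin.sum_univ_three, components_one]
        have t1 : ∀ y, ∑ i, (![1, -e1, -e2] : Fin 3 → QH) i * pd i f y = (2 : ℝ) • D0 f y :=
          fun y => by
          rw [D0_eq_firstOrder, smul_smul]
          norm_num [firstOrder]
        have t2 : ∫ y, F (‖y‖ ^ 2 / 2) • (star ((appellPair l m).2 y) *
            ∑ i, (![1, e1, e2] : Fin 3 → QH) i * pd i f y) = 0 := by
          rw [integral_radial_congr hR hb hF0 (v := fun _ => 0) fun y hy => by
            have := hf.CRbar_eq y hy
            rw [CRbar_eq_firstOrder, firstOrder] at this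
            rw [this, mul_zero]]
          simp
        rw [t2, neg_zero] at h2
        simp only [s1, s2, t1, mul_smul_comm, smul_comm _ (2 : ℝ), integral_smul] at h1 h2
        have hs : ∀ {g : R3 → QH}, ContDiff ℝ 1 g → Continuous fun y => star (g y) :=
          fun hg => (contDiff_star.comp hg).continuous
        have i1 := (integrable_radial_smul hR hb hF' hF'0 (((hs hP.contDiff_fst).continuousOn).mul
          ((hs contDiff_toQ).continuousOn.mul hf1.continuousOn))).smul
            ((l + 1 / 2 + m + 1 : ℝ) / (m + 1))
        have i2 := (integrable_radial_smul hR hb hF' hF'0 (((hs hP.contDiff_snd).continuousOn).mul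
          ((hs contDiff_toQbar).continuousOn.mul hf1.continuousOn))).smul
            ((l + 1 / 2 : ℝ) / (m + 1))
        have e : ∀ y, F' (‖y‖ ^ 2 / 2) • (star ((appellPair l (m + 1)).1 y) * f y) =
            ((l + 1 / 2 + m + 1 : ℝ) / (m + 1)) • (F' (‖y‖ ^ 2 / 2) •
              (star ((appellPair l m).1 y) * (star (toQ y) * f y))) +
            ((l + 1 / 2 : ℝ) / (m + 1)) • (F' (‖y‖ ^ 2 / 2) •
              (star ((appellPair l m).2 y) * (star (toQbar y) * f y))) := fun y => by
          rw [appellPair, star_add, star_real_smul, star_real_smul, star_mul, star_mul, add_mul,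
            smul_mul_assoc, smul_mul_assoc, mul_assoc, mul_assoc, smul_add]
          simp only [smul_comm (F' (‖y‖ ^ 2 / 2))]
        simp_rw [e]
        refine (integral_add i1 i2).trans ?_
        simp only [Pi.smul_apply, Pi.mul_apply]
        rw [integral_smul, integral_smul, h1, h2, smul_zero, add_zero, smul_neg, smul_smul]
        congr 2
        ring
    rw [smul_smul] at step
    rw [← add_assoc, Function.iterate_succ_apply]
    convert step using 2
    rw [Nat.factorial_succ m]
    push_cast
    field_simp

end RadialMeanAppell

section SphereIntegral

lemma HasRadialMean.sphereMean_eq {R : ℝ} {u : R3 → QH} {n : ℕ} {c : QH}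
    (h : HasRadialMean R u n c) (hu : ContinuousOn u (ball 0 R)) {r : ℝ} (hr : r ∈ Set.Ioo 0 R) :
    sphereMean u r = (4 * Real.pi * r ^ (2 * n)) • c := by
  have hR : 0 < R := hr.1.trans hr.2
  have habs : |r| < R := by rw [abs_of_pos hr.1]; exact hr.2
  have hv : ContinuousOn (fun y : R3 => ‖y‖ ^ (2 * n) • c) (ball 0 R) :=
    (by fun_prop : Continuous fun y : R3 => ‖y‖ ^ (2 * n) • c).continuousOn
  have h0 := sphereMean_eq_zero hR (hu.sub hv) (fun G b hG hb hG0 => by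
    simp only [Pi.sub_apply, smul_sub]
    rw [integral_sub (integrable_radial_smul hR hb hG.continuous hG0 hu)
      (integrable_radial_smul hR hb hG.continuous hG0 hv), h G b hG.continuous hb hG0, sub_self]) hr
  simp only [sphereMean, Pi.sub_apply] at h0
  rw [integral_sub (integrable_comp_smul_sphere habs hu) (integrable_comp_smul_sphere habs hv),
    sub_eq_zero] at h0
  rw [sphereMean, h0, mul_smul, ← sphereMean_const _ r, sphereMean]
  congr 1
  funext ω
  rw [norm_smul, norm_eq_of_mem_sphere ω, mul_one, Real.norm_eq_abs, abs_of_pos hr.1]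

lemma barPt_barPt (y : R3) : barPt (barPt y) = y := by
  ext i
  fin_cases i <;> simp [barPt, mk3]

lemma norm_barPt (y : R3) : ‖barPt y‖ = ‖y‖ := by
  simp [EuclideanSpace.norm_eq, Fin.sum_univ_three, barPt, mk3]

lemma toQbar_barPt (y : R3) : toQbar (barPt y) = toQ y := by
  ext <;> simp [barPt, mk3, toQ, toQbar]

lemma star_toQ_mul_toQ (y : R3) : star (toQ y) * toQ y = (‖y‖ ^ 2) • (1 : QH) := by
  rw [EuclideanSpace.norm_sq_eq]
  ext <;> simp [Fin.sum_univ_three, components_one] <;> ring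

lemma appellPair_smul (l m : ℕ) (r : ℝ) (x : R3) :
    (appellPair l m).1 (r • x) = r ^ (l + m) • (appellPair l m).1 x ∧
    (appellPair l m).2 (r • x) = r ^ (l + m) • (appellPair l m).2 x := by
  have hz : zeta (r • x) = r • zeta x := zetaLin.map_smul r x
  have hq : toQ (r • x) = r • toQ x := toQLin.map_smul r x
  have hb : toQbar (r • x) = r • toQbar x := toQbarLin.map_smul r x
  induction m with
  | zero => simp [appellPair, hz, smul_pow]
  | succ m ih =>
    constructor <;>
    · simp only [appellPair, ih.1, ih.2, hq, hb, smul_mul_smul_comm, smul_add, ← add_assoc,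
        ← pow_succ', smul_comm _ (r ^ (l + m + 1))]

lemma star_kelvin_appell {n l : ℕ} (hl : l ≤ n) {y : R3} (hy : y ≠ 0) (q : QH) :
    star (kelvin (appell n l) (barPt y)) * ((‖y‖⁻¹ • toQ y) * q) =
      ((‖y‖ ^ (2 * n + 2))⁻¹ * ((n.factorial * (2 * l + 1).factorial) /
        ((n + l + 1).factorial * l.factorial))) • (star ((appellPair l (n - l)).1 y) * q) := by
  have hy0 : ‖y‖ ≠ 0 := norm_ne_zero_iff.2 hy
  have h : star (toQ y) * (toQ y * q) = (‖y‖ ^ 2) • q := by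
    rw [← mul_assoc, star_toQ_mul_toQ, smul_mul_assoc, one_mul]
  rw [kelvin, norm_barPt, barPt_barPt, toQbar_barPt, appell_eq_smul_appellPair hl,
    (appellPair_smul l (n - l) _ y).1, Nat.add_sub_cancel' hl]
  simp only [star_mul, star_real_smul, smul_mul_assoc, mul_smul_comm, mul_assoc, h, smul_smul,
    inv_pow, ← pow_mul]
  congr 1
  field_simp
  ring

end SphereIntegral

/-- the Taylor coefficients as surface integrals over a sphere of radius ρ. -/
theorem taylor_coeff_surface_integral (ρ R : ℝ) (hρ : 0 < ρ) (hρR : ρ < R)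
    (f : R3 → QH) (hf1 : ContDiffOn ℝ 1 f (ball (0 : R3) R))
    (hmono : ∀ x ∈ ball (0 : R3) R, CRbar f x = 0) (n l : ℕ) (hl : l ≤ n) :
    ((n.factorial : ℝ))⁻¹ • (DbarC^[l] (D0^[n - l] f)) 0 =
      (((n : ℝ) + 1) / (4 ^ (l + 1) * Real.pi)) •
        sphereIntegral ρ
          (fun y => star (outerAppell n l (barPt y)) * ((‖y‖⁻¹ • toQ y) * f y)) := by
  have hf : IsMonogenicOnBall R f := ⟨contDiffOn_of_CRbar hf1 hmono, hmono⟩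
  have hR : 0 < R := hρ.trans hρR
  have hu : ContinuousOn (fun y => star ((appellPair l (n - l)).1 y) * f y) (ball 0 R) :=
    (contDiff_star.comp (isAppellPair_appellPair l (n - l)).contDiff_fst).continuous.continuousOn.mul
      hf1.continuousOn
  have hmean := (hf.hasRadialMean_appellPair hR l (n - l)).sphereMean_eq hu ⟨hρ, hρR⟩
  rw [sphereMean, Nat.add_sub_cancel' hl] at hmean
  have hint : ∀ ω : sphere (0 : R3) 1, ρ ^ 2 • (star (outerAppell n l (barPt (ρ • (ω : R3)))) *
      ((‖ρ • (ω : R3)‖⁻¹ • toQ (ρ • (ω : R3))) * f (ρ • (ω : R3)))) =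
      (ρ ^ 2 * (((n + l + 1).factorial * (n - l).factorial : ℝ) /
        (n.factorial * (n + 1).factorial)) * ((ρ ^ (2 * n + 2))⁻¹ *
        ((n.factorial * (2 * l + 1).factorial) / ((n + l + 1).factorial * l.factorial)))) •
        (star ((appellPair l (n - l)).1 (ρ • (ω : R3))) * f (ρ • (ω : R3))) := fun ω => by
    have hnorm : ‖ρ • (ω : R3)‖ = ρ := by
      rw [norm_smul, norm_eq_of_mem_sphere ω, mul_one, Real.norm_eq_abs, abs_of_pos hρ]
    have hne : ρ • (ω : R3) ≠ 0 := norm_ne_zero_iff.1 (by rw [hnorm]; exact hρ.ne')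
    rw [outerAppell, star_real_smul, smul_mul_assoc, star_kelvin_appell hl hne, hnorm, smul_smul,
      smul_smul, mul_assoc]
  simp only [sphereIntegral, hint]
  rw [integral_smul, hmean, smul_smul, smul_smul, smul_smul]
  congr 1
  rw [Nat.factorial_succ n]
  push_cast
  have hρ0 := hρ.ne'
  field_simp
  ring
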